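/- arXiv:0804.0816 — 6 statements merged into one kernel-verified Lean document; each statement's English description precedes it below -/
import Mathlib

section
/- Let (q_{ij}) be a standard braiding matrix whose associated generalized Cartan matrix C = (a_{ij}) is the finite Cartan matrix of type C_θ (θ ≥ 3), D_θ (θ ≥ 4), E_6, E_7, E_8, or F_4. Then (q_{ij}) is of Cartan type, i.e. q_{ij}q_{ji} = q_{ii}^{a_{ij}} for all i ≠ j. -/
/-- The quantum number `(m)_t = 1 + t + ⋯ + t^{m−1}`. -/
def qnum {k : Type*} [Field k] (t : k) (m : ℕ) : k := ∑ i ∈ Finset.range m, t ^ i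

/-- The bicharacter `χ : ℤ^n × ℤ^n → k^×` determined by `χ(e_i, e_j) = q_{ij}`. -/
def chiOf {k : Type*} [Field k] {n : ℕ} (q : Fin n → Fin n → k) (a b : Fin n → ℤ) : k :=
  ∏ i, ∏ j, q i j ^ (a i * b j)

/-- The set of `m ∈ ℕ₀` with `(m+1)_{q̃_{ii}} (q̃_{ii}^m q̃_{ij} q̃_{ji} − 1) = 0`, where
`q̃_{ij} = χ(f_i, f_j)` is the braiding matrix with respect to the ordered basis `F`. -/
def mSet {k : Type*} [Field k] {n : ℕ} (q : Fin n → Fin n → k)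
    (F : Fin n → Fin n → ℤ) (i j : Fin n) : Set ℕ :=
  { m | qnum (chiOf q (F i) (F i)) (m + 1) *
      ((chiOf q (F i) (F i)) ^ m * chiOf q (F i) (F j) * chiOf q (F j) (F i) - 1) = 0 }

/-- `m_{ij}(F)` is defined iff the above set is nonempty. -/
def mDef {k : Type*} [Field k] {n : ℕ} (q : Fin n → Fin n → k)
    (F : Fin n → Fin n → ℤ) (i j : Fin n) : Prop :=
  (mSet q F i j).Nonempty

/-- `m_{ij}(F)`, the minimal element of the above set (junk value `0` if undefined). -/
noncomputable def mVal {k : Type*} [Field k] {n : ℕ} (q : Fin n → Fin n → k)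
    (F : Fin n → Fin n → ℤ) (i j : Fin n) : ℕ :=
  sInf (mSet q F i j)

/-- The pseudo-reflection `s_{i,F}` applied to the ordered basis `F`:
`f_j ↦ f_j + m_{ij}(F) f_i` for `j ≠ i`, and `f_i ↦ −f_i`. -/
noncomputable def reflectBasis {k : Type*} [Field k] {n : ℕ} (q : Fin n → Fin n → k)
    (F : Fin n → Fin n → ℤ) (i : Fin n) : Fin n → Fin n → ℤ :=
  fun j => if j = i then -F i else F j + (mVal q F i j : ℤ) • F i

/-- The canonical (ordered) basis `E = (e_1, …, e_n)` of `ℤ^n`. -/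
def canBasis {n : ℕ} : Fin n → Fin n → ℤ := fun i j => if j = i then 1 else 0

/-- The set of points `𝔓(χ)` of the Weyl groupoid: the smallest set of ordered bases of `ℤ^n`
containing `E` and closed under `F ↦ s_{i,F}(F)` whenever defined. -/
inductive InWeylOrbit {k : Type*} [Field k] {n : ℕ} (q : Fin n → Fin n → k) :
    (Fin n → Fin n → ℤ) → Prop
  | base : InWeylOrbit q canBasis
  | step (F : Fin n → Fin n → ℤ) (i : Fin n) (hF : InWeylOrbit q F)
      (hdef : ∀ j, j ≠ i → mDef q F i j) : InWeylOrbit q (reflectBasis q F i)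

/-- The braiding matrix `(q_{ij})` is standard: for every `F ∈ 𝔓(χ)` all `m_{ij}(F)` are
defined, and they are unchanged by all the reflections `s_{l,F}`. -/
def IsStandard {k : Type*} [Field k] {n : ℕ} (q : Fin n → Fin n → k) : Prop :=
  (∀ F, InWeylOrbit q F → ∀ i j : Fin n, i ≠ j → mDef q F i j) ∧
  (∀ F, InWeylOrbit q F → ∀ (l i j : Fin n), i ≠ j →
    mVal q (reflectBasis q F l) i j = mVal q F i j)

/-- The generalized Cartan matrix associated to a standard braiding:
`a_{ii} = 2` and `a_{ij} = −m_{ij}(E)` for `i ≠ j`. -/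
noncomputable def cartanOf {k : Type*} [Field k] {n : ℕ} (q : Fin n → Fin n → k) : Fin n → Fin n → ℤ :=
  fun i j => if i = j then 2 else -(mVal q canBasis i j : ℤ)

/-- The finite Cartan matrix of type `C_θ` (θ ≥ 3), enumerated along the chain with the
double edge at the last pair: `m_{θ−1,θ} = 2` (here written 0-based). -/
def IsTypeC (θ : ℕ) (a : Fin θ → Fin θ → ℤ) : Prop :=
  3 ≤ θ ∧ ∀ i j : Fin θ, a i j =
    if i = j then 2
    else if i.1 = θ - 2 ∧ j.1 = θ - 1 then -2
    else if i.1 + 1 = j.1 ∨ j.1 + 1 = i.1 then -1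
    else 0

/-- The finite Cartan matrix of type `D_θ` (θ ≥ 4): a chain `1 − 2 − ⋯ − (θ−1)` together with
the extra vertex `θ` attached to `θ−2` (0-based in the formula). -/
def IsTypeD (θ : ℕ) (a : Fin θ → Fin θ → ℤ) : Prop :=
  4 ≤ θ ∧ ∀ i j : Fin θ, a i j =
    if i = j then 2
    else if (i.1 + 1 = j.1 ∧ j.1 + 1 ≤ θ - 1) ∨ (j.1 + 1 = i.1 ∧ i.1 + 1 ≤ θ - 1) ∨
            (i.1 = θ - 3 ∧ j.1 = θ - 1) ∨ (j.1 = θ - 3 ∧ i.1 = θ - 1) then -1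
    else 0

/-- A simply laced Cartan matrix with the given (0-based) edge list. -/
def IsSimplyLacedWith (θ : ℕ) (edges : List (ℕ × ℕ)) (a : Fin θ → Fin θ → ℤ) : Prop :=
  ∀ i j : Fin θ, a i j =
    if i = j then 2
    else if (i.1, j.1) ∈ edges ∨ (j.1, i.1) ∈ edges then -1
    else 0

/-- The finite Cartan matrices of types `E_6`, `E_7`, `E_8` (0-based edge lists). -/
def IsTypeE (θ : ℕ) (a : Fin θ → Fin θ → ℤ) : Prop :=
  (θ = 6 ∧ IsSimplyLacedWith θ [(0,1),(1,2),(2,3),(2,4),(4,5)] a) ∨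
  (θ = 7 ∧ IsSimplyLacedWith θ [(0,1),(1,2),(2,3),(3,4),(3,5),(5,6)] a) ∨
  (θ = 8 ∧ IsSimplyLacedWith θ [(0,1),(1,2),(2,3),(3,4),(4,5),(4,6),(6,7)] a)

/-- The finite Cartan matrix of type `F_4`: chain `1 − 2 ⇒ 3 − 4` with `m_{32} = 2`
(0-based: `a_{2,1} = −2`). -/
def IsTypeF (θ : ℕ) (a : Fin θ → Fin θ → ℤ) : Prop :=
  θ = 4 ∧ ∀ i j : Fin θ, a i j =
    if i = j then 2
    else if i.1 = 2 ∧ j.1 = 1 then -2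
    else if i.1 + 1 = j.1 ∨ j.1 + 1 = i.1 then -1
    else 0


theorem chiOf_add_left {k : Type*} [Field k] {n : ℕ} (q : Fin n → Fin n → k)
    (hq : ∀ i j, q i j ≠ 0) (a b c : Fin n → ℤ) :
    chiOf q (a + b) c = chiOf q a c * chiOf q b c := by
  simp only [chiOf, ← Finset.prod_mul_distrib]
  refine Finset.prod_congr rfl fun i _ => Finset.prod_congr rfl fun j _ => ?_
  rw [← zpow_add₀ (hq i j), Pi.add_apply, add_mul]

theorem chiOf_add_right {k : Type*} [Field k] {n : ℕ} (q : Fin n → Fin n → k)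
    (hq : ∀ i j, q i j ≠ 0) (a b c : Fin n → ℤ) :
    chiOf q c (a + b) = chiOf q c a * chiOf q c b := by
  simp only [chiOf, ← Finset.prod_mul_distrib]
  refine Finset.prod_congr rfl fun i _ => Finset.prod_congr rfl fun j _ => ?_
  rw [← zpow_add₀ (hq i j), Pi.add_apply, mul_add]

theorem chiOf_neg_left {k : Type*} [Field k] {n : ℕ} (q : Fin n → Fin n → k)
    (a c : Fin n → ℤ) : chiOf q (-a) c = (chiOf q a c)⁻¹ := by
  simp only [chiOf, ← Finset.prod_inv_distrib]
  refine Finset.prod_congr rfl fun i _ => Finset.prod_congr rfl fun j _ => ?_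
  rw [← zpow_neg, Pi.neg_apply, neg_mul]

theorem chiOf_neg_right {k : Type*} [Field k] {n : ℕ} (q : Fin n → Fin n → k)
    (a c : Fin n → ℤ) : chiOf q c (-a) = (chiOf q c a)⁻¹ := by
  simp only [chiOf, ← Finset.prod_inv_distrib]
  refine Finset.prod_congr rfl fun i _ => Finset.prod_congr rfl fun j _ => ?_
  rw [← zpow_neg, Pi.neg_apply, mul_neg]

theorem chiOf_smul_left {k : Type*} [Field k] {n : ℕ} (q : Fin n → Fin n → k)
    (m : ℕ) (a c : Fin n → ℤ) : chiOf q ((m : ℤ) • a) c = (chiOf q a c) ^ m := by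
  simp only [chiOf, ← Finset.prod_pow]
  refine Finset.prod_congr rfl fun i _ => Finset.prod_congr rfl fun j _ => ?_
  rw [← zpow_natCast, ← zpow_mul, Pi.smul_apply, smul_eq_mul]
  congr 1; ring

theorem chiOf_smul_right {k : Type*} [Field k] {n : ℕ} (q : Fin n → Fin n → k)
    (m : ℕ) (a c : Fin n → ℤ) : chiOf q c ((m : ℤ) • a) = (chiOf q c a) ^ m := by
  simp only [chiOf, ← Finset.prod_pow]
  refine Finset.prod_congr rfl fun i _ => Finset.prod_congr rfl fun j _ => ?_
  rw [← zpow_natCast, ← zpow_mul, Pi.smul_apply, smul_eq_mul]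
  congr 1; ring

theorem chiOf_ne_zero {k : Type*} [Field k] {n : ℕ} (q : Fin n → Fin n → k)
    (hq : ∀ i j, q i j ≠ 0) (a b : Fin n → ℤ) : chiOf q a b ≠ 0 :=
  Finset.prod_ne_zero_iff.2 fun i _ => Finset.prod_ne_zero_iff.2 fun j _ => zpow_ne_zero _ (hq i j)

theorem chiOf_can {k : Type*} [Field k] {n : ℕ} (q : Fin n → Fin n → k) (i j : Fin n) :
    chiOf q (canBasis i) (canBasis j) = q i j := by
  unfold chiOf canBasis
  rw [Finset.prod_eq_single i, Finset.prod_eq_single j]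
  · simp
  · intro b _ hb; simp [hb]
  · simp
  · intro b _ hb; simp [hb]
  · simp

/-- The abstract data used in the argument. -/
structure Sys {k S ι : Type*} [Field k] (d : S → ι → k) (p : S → ι → ι → k)
    (r : S → ι → S) (M : ι → ι → ℕ) : Prop where
  d0 : ∀ F i, d F i ≠ 0
  p0 : ∀ F i j, p F i j ≠ 0
  symm : ∀ F i j, p F i j = p F j i
  h0 : ∀ F i j, i ≠ j → M i j = 0 → p F i j = 1
  h1 : ∀ F i j, i ≠ j → M i j = 1 → p F i j ≠ 1 ∧ (d F i = -1 ∨ d F i * p F i j = 1)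
  h2 : ∀ F i j, i ≠ j → M i j = 2 → d F i ≠ -1
  rd : ∀ F i j, j ≠ i → d (r F i) j = d F j * p F i j ^ M i j * d F i ^ (M i j * M i j)
  rdi : ∀ F i, d (r F i) i = d F i
  rpi : ∀ F i j, j ≠ i → p (r F i) i j * (p F i j * d F i ^ (2 * M i j)) = 1
  rp : ∀ F i j l, j ≠ i → l ≠ i → p (r F i) j l =
    p F j l * p F i j ^ M i l * p F i l ^ M i j * d F i ^ (2 * M i j * M i l)

section
variable {k S ι : Type*} [Field k] {d : S → ι → k} {p : S → ι → ι → k}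
    {r : S → ι → S} {M : ι → ι → ℕ}

/-- Cartan condition at the pair `(i,j)`, at every point. -/
def Gd (d : S → ι → k) (p : S → ι → ι → k) (M : ι → ι → ℕ) (i j : ι) : Prop :=
  ∀ F, d F i ^ M i j * p F i j = 1

theorem Sys.L6 (h : Sys d p r M) {i j : ι} (hij : i ≠ j) (m : M i j = 0) : Gd d p M i j := by
  intro F; rw [m, h.h0 F i j hij m]; simp

theorem Sys.x1 (h : Sys d p r M) {i j l : ι} (hij : i ≠ j) (hil : i ≠ l) (hjl : j ≠ l)
    (mj : M i j = 1) (ml : M i l = 1) (m0 : M j l = 0) (F : S) :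
    (d F i * p F i j) * (d F i * p F i l) = 1 := by
  have e := h.rp F i j l hij.symm hil.symm
  rw [h.h0 _ j l hjl m0, h.h0 _ j l hjl m0, mj, ml] at e
  linear_combination -e

theorem Sys.L1 (h : Sys d p r M) {i j l : ι} (hij : i ≠ j) (hil : i ≠ l) (hjl : j ≠ l)
    (mj : M i j = 1) (ml : M i l = 1) (m0 : M j l = 0) (g : Gd d p M i j) : Gd d p M i l := by
  intro F
  have e := h.x1 hij hil hjl mj ml m0 F
  have := g F
  rw [mj, pow_one] at this
  rw [ml, pow_one]
  rw [this, one_mul] at e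
  exact e

theorem Sys.L2 (h : Sys d p r M) {i j : ι} (hij : i ≠ j)
    (mj : M i j = 1) (mi : M j i = 1) (g : Gd d p M j i) : Gd d p M i j := by
  intro F
  rw [mj, pow_one]
  rcases (h.h1 F i j hij mj).2 with hd | hd
  · have g1 := g F
    have g2 := g (r F i)
    have e1 := h.rd F i j hij.symm
    have e2 := h.rpi F i j hij.symm
    rw [h.symm _ j i] at g1 g2
    rw [mi, pow_one] at g1 g2
    rw [mj, hd] at e1 e2
    rw [e1] at g2
    have : d F j = -1 := by
      linear_combination (-1) * g2 - d F j * e2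
    rw [this] at g1
    rw [hd]; exact g1
  · exact hd

theorem Sys.L3 (h : Sys d p r M) {a b c : ι} (hab : a ≠ b) (hbc : b ≠ c) (hac : a ≠ c)
    (ma : M b a = 1) (mc : M b c = 2) (m0 : M a c = 0) : Gd d p M b a ∧ Gd d p M b c := by
  have ga : Gd d p M b a := by
    intro F
    rw [ma, pow_one]
    exact (h.h1 F b a hab.symm ma).2.resolve_left (h.h2 F b c hbc mc)
  refine ⟨ga, fun F => ?_⟩
  have e := h.rp F b a c hab hbc.symm
  have g := ga F
  rw [h.h0 _ a c hac m0, h.h0 _ a c hac m0, ma, mc] at e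
  rw [ma, pow_one] at g
  rw [mc]
  linear_combination (-1) * e - (d F b * p F b a + 1) * d F b ^ 2 * p F b c * g

theorem Sys.L4 (h : Sys d p r M) {a b c : ι} (hab : a ≠ b) (hbc : b ≠ c) (hac : a ≠ c)
    (ma : M b a = 1) (mc : M b c = 2) (mb : M c b = 1) (m0 : M c a = 0)
    (ga : Gd d p M b a) (gc : Gd d p M b c) : Gd d p M c b := by
  intro F
  rw [mb, pow_one]
  rcases (h.h1 F c b hbc.symm mb).2 with hd | hd
  · have g1 := ga F
    have g2 := ga (r F c)
    have g3 := gc F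
    have e1 := h.rd F c b hbc
    have e2 := h.rp F c b a hbc hac
    rw [h.symm _ b c] at g3
    rw [h.h0 _ c a hac.symm m0] at e2
    rw [ma, pow_one] at g1 g2
    rw [mc] at g3
    simp only [m0, mb, hd, pow_one, pow_zero, mul_one, mul_zero] at e1 e2
    rw [e1, e2] at g2
    rw [hd]
    linear_combination g2 + p F c b * g1
  · exact hd

theorem Sys.L5 (h : Sys d p r M) {i j l t : ι} (hij : i ≠ j) (hil : i ≠ l) (hit : i ≠ t)
    (hjl : j ≠ l) (hjt : j ≠ t) (hlt : l ≠ t)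
    (mj : M i j = 1) (ml : M i l = 1) (mt : M i t = 1)
    (m1 : M j l = 0) (m2 : M j t = 0) (m3 : M l t = 0) : Gd d p M i j := by
  intro F
  have e1 := h.x1 hij hil hjl mj ml m1 F
  have e2 := h.x1 hij hit hjt mj mt m2 F
  have e3 := h.x1 hil hit hlt ml mt m3 F
  rw [mj, pow_one]
  obtain ⟨n1, hd | hd⟩ := h.h1 F i j hij mj
  · have : (d F i * p F i j) ^ 2 = 1 := by
      generalize d F i * p F i j = x at *
      generalize d F i * p F i l = y at *
      generalize d F i * p F i t = z at *
      linear_combination e1 * x * z - x ^ 2 * e3 + e2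
    rcases mul_self_eq_one_iff.1 ((sq _).symm.trans this) with h' | h'
    · exact h'
    · rw [hd] at h'
      exact absurd (by linear_combination -h') n1
  · exact hd
end

theorem isSys {k : Type*} [Field k] {n : ℕ} (q : Fin n → Fin n → k)
    (hq : ∀ i j, q i j ≠ 0) (hstd : IsStandard q) :
    Sys (S := {F // InWeylOrbit q F})
      (fun F i => chiOf q (F.1 i) (F.1 i))
      (fun F i j => chiOf q (F.1 i) (F.1 j) * chiOf q (F.1 j) (F.1 i))
      (fun F i => ⟨reflectBasis q F.1 i, .step F.1 i F.2 fun j hj => hstd.1 _ F.2 i j hj.symm⟩)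
      (fun i j => mVal q canBasis i j) := by
  have key : ∀ F, InWeylOrbit q F → ∀ i j, i ≠ j → mVal q F i j = mVal q canBasis i j := by
    intro F hF
    induction hF with
    | base => intros; rfl
    | step F i hF _ ih => intro a b hab; rw [hstd.2 F hF i a b hab, ih a b hab]
  have mem : ∀ F, InWeylOrbit q F → ∀ i j, i ≠ j → mVal q canBasis i j ∈ mSet q F i j := by
    intro F hF i j hij
    rw [← key F hF i j hij]
    exact Nat.sInf_mem (hstd.1 F hF i j hij)
  have nmem : ∀ F, InWeylOrbit q F → ∀ i j, i ≠ j → ∀ m, m < mVal q canBasis i j →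
      m ∉ mSet q F i j := by
    intro F hF i j hij m hm
    rw [← key F hF i j hij] at hm
    exact Nat.notMem_of_lt_sInf hm
  have nz := chiOf_ne_zero q hq
  constructor
  · intro F i; exact nz _ _
  · intro F i j; exact mul_ne_zero (nz _ _) (nz _ _)
  · intro F i j; exact mul_comm _ _
  · rintro ⟨F, hF⟩ i j hij hm
    have := mem F hF i j hij
    rw [hm] at this
    simp [mSet, qnum] at this
    linear_combination this
  · rintro ⟨F, hF⟩ i j hij hm
    have h1 := mem F hF i j hij
    have h2 := nmem F hF i j hij 0 (by omega)
    rw [hm] at h1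
    simp only [mSet, qnum, Set.mem_ofPred_eq, Finset.sum_range_succ, Finset.sum_range_zero] at h1 h2
    constructor
    · intro h; apply h2
      simp only at h
      linear_combination h
    · rcases mul_eq_zero.1 h1 with h | h
      · left; linear_combination h
      · right; linear_combination h
  · rintro ⟨F, hF⟩ i j hij hm
    have h2 := nmem F hF i j hij 1 (by omega)
    simp only [mSet, qnum, Set.mem_ofPred_eq, Finset.sum_range_succ, Finset.sum_range_zero] at h2
    intro h; apply h2
    simp only at h
    rw [h]; ring
  · rintro ⟨F, hF⟩ i j hij
    simp only [reflectBasis, if_neg hij, key F hF i j hij.symm, chiOf_add_left q hq,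
      chiOf_add_right q hq, chiOf_smul_left, chiOf_smul_right]
    ring
  · rintro ⟨F, hF⟩ i
    simp [reflectBasis, chiOf_neg_left, chiOf_neg_right]
  · rintro ⟨F, hF⟩ i j hij
    simp only [reflectBasis, if_neg hij, if_true, key F hF i j hij.symm, chiOf_add_left q hq,
      chiOf_add_right q hq, chiOf_smul_left, chiOf_smul_right, chiOf_neg_left, chiOf_neg_right]
    have h1 := nz (F i) (F i)
    have h2 := nz (F i) (F j)
    have h3 := nz (F j) (F i)
    have h4 := pow_ne_zero (mVal q canBasis i j) h1
    rw [inv_pow, two_mul, pow_add]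
    field_simp
  · rintro ⟨F, hF⟩ i j l hij hil
    simp only [reflectBasis, if_neg hij, if_neg hil, key F hF i j hij.symm,
      key F hF i l hil.symm, chiOf_add_left q hq,
      chiOf_add_right q hq, chiOf_smul_left, chiOf_smul_right]
    ring


section
variable {k S : Type*} [Field k]

theorem Sys.typeC {n : ℕ} {d : S → Fin (n+3) → k} {p : S → Fin (n+3) → Fin (n+3) → k}
    {r : S → Fin (n+3) → S} {M : Fin (n+3) → Fin (n+3) → ℕ} (h : Sys d p r M)
    (hM : ∀ i j : Fin (n+3), i ≠ j → M i j =
      if i.1 = n + 1 ∧ j.1 = n + 2 then 2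
      else if i.1 + 1 = j.1 ∨ j.1 + 1 = i.1 then 1 else 0) :
    ∀ i j, i ≠ j → Gd d p M i j := by
  have hv : ∀ (i j : ℕ) (hi : i < n + 3) (hj : j < n + 3), i ≠ j → M ⟨i, hi⟩ ⟨j, hj⟩ =
      if i = n + 1 ∧ j = n + 2 then 2 else if i + 1 = j ∨ j + 1 = i then 1 else 0 := by
    intro i j hi hj hij
    rw [hM _ _ (by simpa using hij)]
  have L3 := h.L3 (a := ⟨n, by omega⟩) (b := ⟨n+1, by omega⟩) (c := ⟨n+2, by omega⟩)
    (by simp) (by simp) (by simp)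
    (by rw [hv _ _ _ _ (by omega), if_neg (by omega), if_pos (by omega)])
    (by rw [hv _ _ _ _ (by omega), if_pos (by omega)])
    (by rw [hv _ _ _ _ (by omega), if_neg (by omega), if_neg (by omega)])
  have L4 := h.L4 (a := ⟨n, by omega⟩) (b := ⟨n+1, by omega⟩) (c := ⟨n+2, by omega⟩)
    (by simp) (by simp) (by simp)
    (by rw [hv _ _ _ _ (by omega), if_neg (by omega), if_pos (by omega)])
    (by rw [hv _ _ _ _ (by omega), if_pos (by omega)])
    (by rw [hv _ _ _ _ (by omega), if_neg (by omega), if_pos (by omega)])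
    (by rw [hv _ _ _ _ (by omega), if_neg (by omega), if_neg (by omega)]) L3.1 L3.2
  have up : ∀ (i : ℕ) (hi : i + 1 ≤ n + 1), Gd d p M ⟨i+1, by omega⟩ ⟨i, by omega⟩ →
      Gd d p M ⟨i, by omega⟩ ⟨i+1, by omega⟩ := by
    intro i hi g
    exact h.L2 (by simp)
      (by rw [hv _ _ _ _ (by omega), if_neg (by omega), if_pos (by omega)])
      (by rw [hv _ _ _ _ (by omega), if_neg (by omega), if_pos (by omega)]) g
  have down : ∀ t i : ℕ, ∀ ht : i + t = n, Gd d p M ⟨i+1, by omega⟩ ⟨i, by omega⟩ := by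
    intro t
    induction t with
    | zero => intro i ht; obtain rfl : i = n := by omega
              exact L3.1
    | succ t ih =>
      intro i ht
      have g := up (i+1) (by omega) (ih (i+1) (by omega))
      exact h.L1 (by simp) (by simp) (by simp; omega)
        (by rw [hv _ _ _ _ (by omega), if_neg (by omega), if_pos (by omega)])
        (by rw [hv _ _ _ _ (by omega), if_neg (by omega), if_pos (by omega)])
        (by rw [hv _ _ _ _ (by omega), if_neg (by omega), if_neg (by omega)]) g
  rintro ⟨i, hi⟩ ⟨j, hj⟩ hij
  have hij' : i ≠ j := by simpa using hij
  by_cases c1 : i + 1 = j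
  · subst c1
    by_cases c2 : i = n + 1
    · subst c2; exact L3.2
    · exact up i (by omega) (down (n - i) i (by omega))
  by_cases c1 : j + 1 = i
  · subst c1
    by_cases c2 : j = n + 1
    · subst c2; exact L4
    · exact down (n - j) j (by omega)
  exact h.L6 hij (by rw [hv _ _ _ _ hij', if_neg (by omega), if_neg (by omega)])

theorem Sys.typeD {n : ℕ} {d : S → Fin (n+4) → k} {p : S → Fin (n+4) → Fin (n+4) → k}
    {r : S → Fin (n+4) → S} {M : Fin (n+4) → Fin (n+4) → ℕ} (h : Sys d p r M)
    (hM : ∀ i j : Fin (n+4), i ≠ j → M i j =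
      if (i.1 + 1 = j.1 ∧ j.1 + 1 ≤ n + 3) ∨ (j.1 + 1 = i.1 ∧ i.1 + 1 ≤ n + 3) ∨
            (i.1 = n + 1 ∧ j.1 = n + 3) ∨ (j.1 = n + 1 ∧ i.1 = n + 3) then 1 else 0) :
    ∀ i j, i ≠ j → Gd d p M i j := by
  have hv : ∀ (i j : ℕ) (hi : i < n + 4) (hj : j < n + 4), i ≠ j → M ⟨i, hi⟩ ⟨j, hj⟩ =
      if (i + 1 = j ∧ j + 1 ≤ n + 3) ∨ (j + 1 = i ∧ i + 1 ≤ n + 3) ∨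
            (i = n + 1 ∧ j = n + 3) ∨ (j = n + 1 ∧ i = n + 3) then 1 else 0 := by
    intro i j hi hj hij
    rw [hM _ _ (by simpa using hij)]
  have L5 := h.L5 (i := ⟨n+1, by omega⟩) (j := ⟨n, by omega⟩) (l := ⟨n+2, by omega⟩)
    (t := ⟨n+3, by omega⟩)
    (by simp) (by simp) (by simp) (by simp) (by simp) (by simp)
    (by rw [hv _ _ _ _ (by omega), if_pos (by omega)])
    (by rw [hv _ _ _ _ (by omega), if_pos (by omega)])
    (by rw [hv _ _ _ _ (by omega), if_pos (by omega)])
    (by rw [hv _ _ _ _ (by omega), if_neg (by omega)])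
    (by rw [hv _ _ _ _ (by omega), if_neg (by omega)])
    (by rw [hv _ _ _ _ (by omega), if_neg (by omega)])
  have up : ∀ (i : ℕ) (hi : i + 1 ≤ n + 2), Gd d p M ⟨i+1, by omega⟩ ⟨i, by omega⟩ →
      Gd d p M ⟨i, by omega⟩ ⟨i+1, by omega⟩ := by
    intro i hi g
    exact h.L2 (by simp)
      (by rw [hv _ _ _ _ (by omega), if_pos (by omega)])
      (by rw [hv _ _ _ _ (by omega), if_pos (by omega)]) g
  have down : ∀ t i : ℕ, ∀ ht : i + t = n, Gd d p M ⟨i+1, by omega⟩ ⟨i, by omega⟩ := by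
    intro t
    induction t with
    | zero => intro i ht; obtain rfl : i = n := by omega
              exact L5
    | succ t ih =>
      intro i ht
      have g := up (i+1) (by omega) (ih (i+1) (by omega))
      exact h.L1 (by simp) (by simp) (by simp; omega)
        (by rw [hv _ _ _ _ (by omega), if_pos (by omega)])
        (by rw [hv _ _ _ _ (by omega), if_pos (by omega)])
        (by rw [hv _ _ _ _ (by omega), if_neg (by omega)]) g
  have out : ∀ (j : ℕ) (hj : j < n + 4), n + 1 < j → Gd d p M ⟨n+1, by omega⟩ ⟨j, hj⟩ := by
    intro j hj hj'
    exact h.L1 (by simp) (by simp; omega) (by simp; omega)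
        (by rw [hv _ _ _ _ (by omega), if_pos (by omega)])
        (by rw [hv _ _ _ _ (by omega), if_pos (by omega)])
        (by rw [hv _ _ _ _ (by omega), if_neg (by omega)]) L5
  rintro ⟨i, hi⟩ ⟨j, hj⟩ hij
  have hij' : i ≠ j := by simpa using hij
  by_cases c0 : i = n + 1 ∧ n + 1 < j
  · obtain ⟨rfl, c⟩ := c0; exact out j hj c
  by_cases c0 : j = n + 1 ∧ n + 1 < i
  · obtain ⟨rfl, c⟩ := c0
    exact h.L2 hij
      (by rw [hv _ _ _ _ (by omega), if_pos (by omega)])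
      (by rw [hv _ _ _ _ (by omega), if_pos (by omega)]) (out i hi c)
  by_cases c1 : i + 1 = j ∧ i ≤ n
  · obtain ⟨rfl, c⟩ := c1
    exact up i (by omega) (down (n - i) i (by omega))
  by_cases c1 : j + 1 = i ∧ j ≤ n
  · obtain ⟨rfl, c⟩ := c1
    exact down (n - j) j (by omega)
  exact h.L6 hij (by rw [hv _ _ _ _ hij', if_neg (by omega)])

variable {ι : Type*} {d : S → ι → k} {p : S → ι → ι → k} {r : S → ι → S} {M N : ι → ι → ℕ}

theorem Sys.K1 (h : Sys d p r M) (hN : ∀ i j, i ≠ j → M i j = N i j) {i j : ι} (l : ι)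
    (c : (i ≠ j ∧ i ≠ l ∧ j ≠ l) ∧ N i j = 1 ∧ N i l = 1 ∧ N j l = 0)
    (g : Gd d p M i j) : Gd d p M i l := by
  obtain ⟨⟨a, b, e⟩, f⟩ := c
  rw [← hN _ _ a, ← hN _ _ b, ← hN _ _ e] at f
  exact h.L1 a b e f.1 f.2.1 f.2.2 g

theorem Sys.K2 (h : Sys d p r M) (hN : ∀ i j, i ≠ j → M i j = N i j) {i j : ι}
    (c : i ≠ j ∧ N i j = 1 ∧ N j i = 1)
    (g : Gd d p M j i) : Gd d p M i j := by
  obtain ⟨a, f⟩ := c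
  rw [← hN _ _ a, ← hN _ _ a.symm] at f
  exact h.L2 a f.1 f.2 g

theorem Sys.K5 (h : Sys d p r M) (hN : ∀ i j, i ≠ j → M i j = N i j) (i j l t : ι)
    (c : (i ≠ j ∧ i ≠ l ∧ i ≠ t ∧ j ≠ l ∧ j ≠ t ∧ l ≠ t) ∧ N i j = 1 ∧ N i l = 1 ∧ N i t = 1 ∧
      N j l = 0 ∧ N j t = 0 ∧ N l t = 0) : Gd d p M i j := by
  obtain ⟨⟨a1, a2, a3, a4, a5, a6⟩, f⟩ := c
  rw [← hN _ _ a1, ← hN _ _ a2, ← hN _ _ a3, ← hN _ _ a4, ← hN _ _ a5, ← hN _ _ a6] at f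
  obtain ⟨f1, f2, f3, f4, f5, f6⟩ := f
  exact h.L5 a1 a2 a3 a4 a5 a6 f1 f2 f3 f4 f5 f6

theorem Sys.K6 (h : Sys d p r M) (hN : ∀ i j, i ≠ j → M i j = N i j) (L : List (ι × ι))
    (c : ∀ i j, i ≠ j → N i j = 0 ∨ (i, j) ∈ L)
    (g : ∀ e ∈ L, Gd d p M e.1 e.2) : ∀ i j, i ≠ j → Gd d p M i j := by
  intro i j hij
  rcases c i j hij with e | e
  · exact h.L6 hij ((hN _ _ hij).trans e)
  · exact g _ e
end

/-- The table of a simply laced diagram. -/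
def tabE (n : ℕ) (edges : List (ℕ × ℕ)) (i j : Fin n) : ℕ :=
  if (i.1, j.1) ∈ edges ∨ (j.1, i.1) ∈ edges then 1 else 0

/-- The table of `F_4`. -/
def tabF (i j : Fin 4) : ℕ :=
  if i.1 = 2 ∧ j.1 = 1 then 2 else if i.1 + 1 = j.1 ∨ j.1 + 1 = i.1 then 1 else 0

theorem Sys.typeE6 {k S : Type*} [Field k] {d : S → Fin 6 → k} {p : S → Fin 6 → Fin 6 → k}
    {r : S → Fin 6 → S} {M : Fin 6 → Fin 6 → ℕ} (h : Sys d p r M)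
    (hN : ∀ i j, i ≠ j → M i j = tabE 6 [(0,1),(1,2),(2,3),(2,4),(4,5)] i j) :
    ∀ i j, i ≠ j → Gd d p M i j := by
  have g21 := h.K5 hN 2 1 3 4 (by decide)
  have g23 := h.K1 hN 3 (by decide) g21
  have g24 := h.K1 hN 4 (by decide) g21
  have g12 := h.K2 hN (by decide) g21
  have g10 := h.K1 hN 0 (by decide) g12
  have g01 := h.K2 hN (by decide) g10
  have g32 := h.K2 hN (by decide) g23
  have g42 := h.K2 hN (by decide) g24
  have g45 := h.K1 hN 5 (by decide) g42
  have g54 := h.K2 hN (by decide) g45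
  refine h.K6 hN [(2, 1), (2, 3), (2, 4), (1, 2), (1, 0), (0, 1), (3, 2), (4, 2), (4, 5), (5, 4)] (by decide) ?_
  simp only [List.forall_mem_cons]
  exact ⟨g21, g23, g24, g12, g10, g01, g32, g42, g45, g54, by simp⟩

theorem Sys.typeE7 {k S : Type*} [Field k] {d : S → Fin 7 → k} {p : S → Fin 7 → Fin 7 → k}
    {r : S → Fin 7 → S} {M : Fin 7 → Fin 7 → ℕ} (h : Sys d p r M)
    (hN : ∀ i j, i ≠ j → M i j = tabE 7 [(0,1),(1,2),(2,3),(3,4),(3,5),(5,6)] i j) :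
    ∀ i j, i ≠ j → Gd d p M i j := by
  have g32 := h.K5 hN 3 2 4 5 (by decide)
  have g34 := h.K1 hN 4 (by decide) g32
  have g35 := h.K1 hN 5 (by decide) g32
  have g23 := h.K2 hN (by decide) g32
  have g21 := h.K1 hN 1 (by decide) g23
  have g12 := h.K2 hN (by decide) g21
  have g10 := h.K1 hN 0 (by decide) g12
  have g01 := h.K2 hN (by decide) g10
  have g43 := h.K2 hN (by decide) g34
  have g53 := h.K2 hN (by decide) g35
  have g56 := h.K1 hN 6 (by decide) g53
  have g65 := h.K2 hN (by decide) g56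
  refine h.K6 hN [(3, 2), (3, 4), (3, 5), (2, 3), (2, 1), (1, 2), (1, 0), (0, 1), (4, 3), (5, 3), (5, 6), (6, 5)] (by decide) ?_
  simp only [List.forall_mem_cons]
  exact ⟨g32, g34, g35, g23, g21, g12, g10, g01, g43, g53, g56, g65, by simp⟩

theorem Sys.typeE8 {k S : Type*} [Field k] {d : S → Fin 8 → k} {p : S → Fin 8 → Fin 8 → k}
    {r : S → Fin 8 → S} {M : Fin 8 → Fin 8 → ℕ} (h : Sys d p r M)
    (hN : ∀ i j, i ≠ j → M i j = tabE 8 [(0,1),(1,2),(2,3),(3,4),(4,5),(4,6),(6,7)] i j) :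
    ∀ i j, i ≠ j → Gd d p M i j := by
  have g43 := h.K5 hN 4 3 5 6 (by decide)
  have g45 := h.K1 hN 5 (by decide) g43
  have g46 := h.K1 hN 6 (by decide) g43
  have g34 := h.K2 hN (by decide) g43
  have g32 := h.K1 hN 2 (by decide) g34
  have g23 := h.K2 hN (by decide) g32
  have g21 := h.K1 hN 1 (by decide) g23
  have g12 := h.K2 hN (by decide) g21
  have g10 := h.K1 hN 0 (by decide) g12
  have g01 := h.K2 hN (by decide) g10
  have g54 := h.K2 hN (by decide) g45
  have g64 := h.K2 hN (by decide) g46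
  have g67 := h.K1 hN 7 (by decide) g64
  have g76 := h.K2 hN (by decide) g67
  refine h.K6 hN [(4, 3), (4, 5), (4, 6), (3, 4), (3, 2), (2, 3), (2, 1), (1, 2), (1, 0), (0, 1), (5, 4), (6, 4), (6, 7), (7, 6)] (by decide) ?_
  simp only [List.forall_mem_cons]
  exact ⟨g43, g45, g46, g34, g32, g23, g21, g12, g10, g01, g54, g64, g67, g76, by simp⟩

theorem Sys.typeF {k S : Type*} [Field k] {d : S → Fin 4 → k} {p : S → Fin 4 → Fin 4 → k}
    {r : S → Fin 4 → S} {M : Fin 4 → Fin 4 → ℕ} (h : Sys d p r M)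
    (hN : ∀ i j, i ≠ j → M i j = tabF i j) :
    ∀ i j, i ≠ j → Gd d p M i j := by
  have ⟨g23, g21⟩ := h.L3 (a := 3) (b := 2) (c := 1) (by decide) (by decide) (by decide)
    (hN _ _ (by decide)) (hN _ _ (by decide)) (hN _ _ (by decide))
  have g12 := h.L4 (a := 3) (b := 2) (c := 1) (by decide) (by decide) (by decide)
    (hN _ _ (by decide)) (hN _ _ (by decide)) (hN _ _ (by decide)) (hN _ _ (by decide)) g23 g21
  have g32 := h.K2 hN (by decide) g23
  have g10 := h.K1 hN 0 (by decide) g12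
  have g01 := h.K2 hN (by decide) g10
  refine h.K6 hN [(2, 3), (2, 1), (1, 2), (3, 2), (1, 0), (0, 1)] (by decide) ?_
  simp only [List.forall_mem_cons]
  exact ⟨g23, g21, g12, g32, g10, g01, by simp⟩

/-- A standard braiding whose associated generalized Cartan matrix is of finite type
`C_θ`, `D_θ`, `E_6`, `E_7`, `E_8` or `F_4` is of Cartan type:
`q_{ij} q_{ji} = q_{ii}^{a_{ij}}` for all `i ≠ j`. -/
theorem stmt_0 {k : Type*} [Field k] [IsAlgClosed k] [CharZero k]
    (θ : ℕ) (q : Fin θ → Fin θ → k) (hq : ∀ i j, q i j ≠ 0)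
    (hstd : IsStandard q)
    (hC : IsTypeC θ (cartanOf q) ∨ IsTypeD θ (cartanOf q) ∨ IsTypeE θ (cartanOf q) ∨
          IsTypeF θ (cartanOf q)) :
    ∀ i j : Fin θ, i ≠ j → q i j * q j i = q i i ^ (cartanOf q i j) := by
  have H := isSys q hq hstd
  suffices G : ∀ i j : Fin θ, i ≠ j → Gd (S := {F // InWeylOrbit q F})
      (fun F i => chiOf q (F.1 i) (F.1 i))
      (fun F i j => chiOf q (F.1 i) (F.1 j) * chiOf q (F.1 j) (F.1 i))
      (fun i j => mVal q canBasis i j) i j by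
    intro i j hij
    have := G i j hij ⟨canBasis, .base⟩
    simp only [chiOf_can] at this
    rw [cartanOf, if_neg hij, zpow_neg, zpow_natCast]
    exact eq_inv_of_mul_eq_one_right this
  have hM : ∀ i j : Fin θ, i ≠ j → ((mVal q canBasis i j : ℕ) : ℤ) = - cartanOf q i j := by
    intro i j hij; rw [cartanOf, if_neg hij]; simp
  generalize cartanOf q = A at hC hM
  have conv : ∀ i j : Fin θ, i ≠ j → ∀ m : ℕ, A i j = -(m : ℤ) → mVal q canBasis i j = m := by
    intro i j hij m hm
    have := hM i j hij
    omega
  rcases hC with ⟨hθ, hA⟩ | ⟨hθ, hA⟩ | hE | ⟨hθ, hA⟩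
  · obtain ⟨n, rfl⟩ : ∃ n, θ = n + 3 := ⟨θ - 3, by omega⟩
    refine H.typeC fun i j hij => conv i j hij _ ?_
    rw [hA, if_neg hij]
    split_ifs <;> first | rfl | omega
  · obtain ⟨n, rfl⟩ : ∃ n, θ = n + 4 := ⟨θ - 4, by omega⟩
    refine H.typeD fun i j hij => conv i j hij _ ?_
    rw [hA, if_neg hij]
    split_ifs <;> first | rfl | omega
  · rcases hE with ⟨rfl, hA⟩ | ⟨rfl, hA⟩ | ⟨rfl, hA⟩
    · refine H.typeE6 fun i j hij => conv i j hij _ ?_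
      rw [hA, if_neg hij, tabE]
      split_ifs <;> rfl
    · refine H.typeE7 fun i j hij => conv i j hij _ ?_
      rw [hA, if_neg hij, tabE]
      split_ifs <;> rfl
    · refine H.typeE8 fun i j hij => conv i j hij _ ?_
      rw [hA, if_neg hij, tabE]
      split_ifs <;> rfl
  · subst hθ
    refine H.typeF fun i j hij => conv i j hij _ ?_
    rw [hA, if_neg hij, tabF]
    split_ifs <;> rfl
end

section
/- A matrix (q_{ij})_{1≤i,j≤2} with entries in k^× is a standard braiding matrix whose associated generalized Cartan matrix is the finite Cartan matrix of type G_2 (with m_{12} = 3, m_{21} = 1) if and only if one of the following holds: (a) there exists q ∈ k^× which is either not a root of unity or a root of unity of order at least 4, such that q_{11} = q, q_{12}q_{21} = q^{−3}, q_{22} = q³; or (b) there exists a primitive eighth root of unity ζ such that the triple (q_{11}, q_{12}q_{21}, q_{22}) equals (ζ², ζ, ζ^{−1}), (ζ², ζ³, −1), or (ζ, ζ⁵, −1). -/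
section Helpers

variable {k : Type*} [Field k]

theorem aux_chi_add_left {q : Fin 2 → Fin 2 → k} (hq : ∀ i j, q i j ≠ 0) (a b c : Fin 2 → ℤ) :
    chiOf q (a + b) c = chiOf q a c * chiOf q b c := by
  simp only [chiOf, ← Finset.prod_mul_distrib]
  refine Finset.prod_congr rfl fun i _ => Finset.prod_congr rfl fun j _ => ?_
  rw [Pi.add_apply, add_mul, zpow_add₀ (hq i j)]

theorem aux_chi_add_right {q : Fin 2 → Fin 2 → k} (hq : ∀ i j, q i j ≠ 0) (a b c : Fin 2 → ℤ) :
    chiOf q c (a + b) = chiOf q c a * chiOf q c b := by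
  simp only [chiOf, ← Finset.prod_mul_distrib]
  refine Finset.prod_congr rfl fun i _ => Finset.prod_congr rfl fun j _ => ?_
  rw [Pi.add_apply, mul_add, zpow_add₀ (hq i j)]

theorem aux_chi_neg_left (q : Fin 2 → Fin 2 → k) (a c : Fin 2 → ℤ) :
    chiOf q (-a) c = (chiOf q a c)⁻¹ := by
  simp only [chiOf, ← Finset.prod_inv_distrib]
  refine Finset.prod_congr rfl fun i _ => Finset.prod_congr rfl fun j _ => ?_
  rw [Pi.neg_apply, neg_mul, zpow_neg]

theorem aux_chi_neg_right (q : Fin 2 → Fin 2 → k) (a c : Fin 2 → ℤ) :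
    chiOf q c (-a) = (chiOf q c a)⁻¹ := by
  simp only [chiOf, ← Finset.prod_inv_distrib]
  refine Finset.prod_congr rfl fun i _ => Finset.prod_congr rfl fun j _ => ?_
  rw [Pi.neg_apply, mul_neg, zpow_neg]

theorem aux_chi_ne {q : Fin 2 → Fin 2 → k} (hq : ∀ i j, q i j ≠ 0) (a c : Fin 2 → ℤ) :
    chiOf q a c ≠ 0 := by
  simp only [chiOf]
  exact Finset.prod_ne_zero_iff.2 fun i _ => Finset.prod_ne_zero_iff.2 fun j _ =>
    zpow_ne_zero _ (hq i j)

def M3 (a b : k) : Prop :=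
  (a ^ 2 = -1 ∨ a ^ 3 * b = 1) ∧ b ≠ 1 ∧ a ≠ -1 ∧ a * b ≠ 1 ∧ 1 + a + a ^ 2 ≠ 0 ∧ a ^ 2 * b ≠ 1

def M1 (b c : k) : Prop := b ≠ 1 ∧ (c = -1 ∨ c * b = 1)

def PP (a b c : k) : Prop :=
  (∃ p : k, p ≠ 0 ∧ (∀ n : ℕ, 0 < n → p ^ n = 1 → 4 ≤ n) ∧
          a = p ∧ b = (p ^ 3)⁻¹ ∧ c = p ^ 3) ∨
      (∃ ζ : k, IsPrimitiveRoot ζ 8 ∧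
          ((a = ζ ^ 2 ∧ b = ζ ∧ c = ζ⁻¹) ∨
           (a = ζ ^ 2 ∧ b = ζ ^ 3 ∧ c = -1) ∨
           (a = ζ ∧ b = ζ ^ 5 ∧ c = -1)))

theorem aux_prim8 [CharZero k] {z : k} : IsPrimitiveRoot z 8 ↔ z ^ 4 = -1 := by
  constructor
  · intro h
    have h8 := h.pow_eq_one
    have h4 : z ^ 4 ≠ 1 := h.pow_ne_one_of_pos_of_lt (by norm_num) (by norm_num)
    have : (z ^ 4 - 1) * (z ^ 4 + 1) = 0 := by linear_combination h8
    rcases mul_eq_zero.1 this with h | h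
    · exact absurd (sub_eq_zero.1 h) h4
    · linear_combination h
  · intro h
    have : IsPrimitiveRoot z (2 ^ (2 + 1)) := by
      rw [IsPrimitiveRoot.iff_orderOf]
      apply orderOf_eq_prime_pow
      · norm_num [h]
      · norm_num
        linear_combination (z ^ 4 - 1) * h
    simpa using this

theorem aux_P_M3 [CharZero k] {a b c : k} (h : PP a b c) : M3 a b ∧ M1 b c := by
  have two : (2 : k) ≠ 0 := two_ne_zero
  rcases h with ⟨p, hp, hn, rfl, rfl, rfl⟩ | ⟨z, hz, h⟩
  · have h1 : a ≠ 1 := fun h => by have := hn 1 (by norm_num) (by simpa using h); omega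
    have h2 : a ^ 2 ≠ 1 := fun h => by have := hn 2 (by norm_num) h; omega
    have h3 : a ^ 3 ≠ 1 := fun h => by have := hn 3 (by norm_num) h; omega
    refine ⟨⟨Or.inr (by field_simp), ?_, ?_, ?_, ?_, ?_⟩, ?_, Or.inr (by field_simp)⟩
    · simpa using h3
    · rintro rfl; apply h2; norm_num
    · intro h; field_simp at h; exact h2 h.symm
    · intro h; apply h3; linear_combination (a - 1) * h
    · intro h; field_simp at h; exact h1 h.symm
    · simpa using h3
  · rw [aux_prim8] at hz
    have hz0 : z ≠ 0 := by rintro rfl; norm_num at hz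
    have k1 : z ≠ 1 := by rintro rfl; apply two; linear_combination hz
    have k1' : z ≠ -1 := by rintro rfl; apply two; linear_combination hz
    have k2 : z ^ 2 ≠ 1 := by intro h; apply two; linear_combination hz - (z ^ 2 + 1) * h
    have k2' : z ^ 2 ≠ -1 := by intro h; apply two; linear_combination hz - (z ^ 2 - 1) * h
    have k3 : z ^ 3 ≠ 1 := by
      intro h; apply k1'; linear_combination hz - z * h
    have k3' : z ^ 3 ≠ -1 := by
      intro h; apply k1; linear_combination -hz + z * h
    rcases h with ⟨e1, e2, e3⟩ | ⟨e1, e2, e3⟩ | ⟨e1, e2, e3⟩ <;> rw [e1, e2, e3]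
    · refine ⟨⟨Or.inl (by linear_combination hz), k1, k2', ?_, ?_, ?_⟩, k1, Or.inr (by field_simp)⟩
      · intro h; apply k3; linear_combination h
      · intro h; exact pow_ne_zero 2 hz0 (by linear_combination h - hz)
      · intro h; apply k1'; linear_combination z * hz - h
    · refine ⟨⟨Or.inl (by linear_combination hz), k3, k2', ?_, ?_, ?_⟩, k3, Or.inl rfl⟩
      · intro h; apply k1'; linear_combination z * hz - h
      · intro h; exact pow_ne_zero 2 hz0 (by linear_combination h - hz)
      · intro h; apply k3'; linear_combination z ^ 3 * hz - h
    · have k5 : z ^ 5 ≠ 1 := by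
        intro h; apply k1'; linear_combination z * hz - h
      refine ⟨⟨Or.inr (by linear_combination (z ^ 4 - 1) * hz), k5, k1', ?_, ?_, ?_⟩, k5, Or.inl rfl⟩
      · intro h; apply k2'; linear_combination z ^ 2 * hz - h
      · intro h; apply k3; linear_combination (z - 1) * h
      · intro h; apply k3'; linear_combination z ^ 3 * hz - h

theorem aux_P_s1 [CharZero k] {a b c : k} (h : PP a b c) :
    PP a ((a ^ 6)⁻¹ * b⁻¹) (c * b ^ 3 * a ^ 9) := by
  rcases h with ⟨p, hp, hn, rfl, rfl, rfl⟩ | ⟨z, hz, h⟩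
  · left
    exact ⟨a, hp, hn, rfl, by field_simp, by field_simp⟩
  · right
    refine ⟨z, hz, ?_⟩
    rw [aux_prim8] at hz
    have hz0 : z ≠ 0 := by rintro rfl; norm_num at hz
    rcases h with ⟨e1, e2, e3⟩ | ⟨e1, e2, e3⟩ | ⟨e1, e2, e3⟩ <;> rw [e1, e2, e3]
    · right; left
      refine ⟨rfl, ?_, ?_⟩
      · field_simp
        linear_combination -(z ^ 12 - z ^ 8 + z ^ 4 - 1) * hz
      · field_simp
        linear_combination (z ^ 16 - z ^ 12 + z ^ 8 - z ^ 4 + 1) * hz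
    · left
      refine ⟨rfl, ?_, ?_⟩
      · field_simp
        linear_combination -(z ^ 12 - z ^ 8 + z ^ 4 - 1) * hz
      · field_simp
        linear_combination -(z ^ 24 - z ^ 20 + z ^ 16 - z ^ 12 + z ^ 8 - z ^ 4 + 1) * hz
    · right; right
      refine ⟨rfl, ?_, ?_⟩
      · field_simp
        linear_combination -(z ^ 12 - z ^ 8 + z ^ 4 - 1) * hz
      · linear_combination -(z ^ 20 - z ^ 16 + z ^ 12 - z ^ 8 + z ^ 4 - 1) * hz

theorem aux_P_s2 [CharZero k] {a b c : k} (h : PP a b c) :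
    PP (a * b * c) (b⁻¹ * (c ^ 2)⁻¹) c := by
  rcases h with ⟨p, hp, hn, rfl, rfl, rfl⟩ | ⟨z, hz, h⟩
  · left
    exact ⟨a, hp, hn, by field_simp, by field_simp, rfl⟩
  · right
    refine ⟨z, hz, ?_⟩
    rw [aux_prim8] at hz
    have hz0 : z ≠ 0 := by rintro rfl; norm_num at hz
    rcases h with ⟨e1, e2, e3⟩ | ⟨e1, e2, e3⟩ | ⟨e1, e2, e3⟩ <;> rw [e1, e2, e3]
    · left
      exact ⟨by field_simp, by field_simp, rfl⟩
    · right; right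
      refine ⟨?_, ?_, rfl⟩
      · linear_combination -z * hz
      · field_simp
        linear_combination -(z ^ 4 - 1) * hz
    · right; left
      refine ⟨?_, ?_, rfl⟩
      · linear_combination -z ^ 2 * hz
      · field_simp
        linear_combination -(z ^ 4 - 1) * hz

theorem aux_class [CharZero k] {a b c : k} (ha : a ≠ 0) (hb : b ≠ 0)
    (h3 : M3 a b) (h1 : M1 b c)
    (s1 : M1 ((a ^ 6)⁻¹ * b⁻¹) (c * b ^ 3 * a ^ 9))
    (s2 : M3 (a * b * c) (b⁻¹ * (c ^ 2)⁻¹)) : PP a b c := by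
  obtain ⟨h3, n0, n1, n2, n3, n4⟩ := h3
  obtain ⟨_, h1⟩ := h1
  have key : a ^ 3 * b = 1 → c * b = 1 → PP a b c := by
    intro h3 hc
    left
    have a3 : a ^ 3 ≠ 1 := by
      intro h; apply n0; rw [h] at h3; simpa using h3
    have a1 : a ≠ 1 := by rintro rfl; simp at a3
    refine ⟨a, ha, ?_, rfl, ?_, ?_⟩
    · intro n hn h
      by_contra hlt
      have : n = 1 ∨ n = 2 ∨ n = 3 := by omega
      rcases this with rfl | rfl | rfl
      · exact a1 (by simpa using h)
      · have : (a - 1) * (a + 1) = 0 := by linear_combination h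
        rcases mul_eq_zero.1 this with h | h
        · exact a1 (sub_eq_zero.1 h)
        · exact n1 (by linear_combination h)
      · exact a3 h
    · field_simp; linear_combination h3
    · apply mul_right_cancel₀ hb; rw [hc, h3]
  by_cases h3' : a ^ 3 * b = 1
  · by_cases hc : c * b = 1
    · exact key h3' hc
    · obtain rfl : c = -1 := h1.resolve_right hc
      right
      refine ⟨a, ?_⟩
      rw [aux_prim8]
      rcases s2.1 with h | h
      · have a4 : a ^ 4 = -1 := by
          linear_combination a ^ 4 * h - (a ^ 3 * b + 1) * h3'
        exact ⟨a4, Or.inr (Or.inr ⟨rfl, by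
          apply mul_left_cancel₀ (pow_ne_zero 3 ha); rw [h3']
          linear_combination -(a ^ 4 - 1) * a4, rfl⟩)⟩
      · exfalso; apply hc
        field_simp at h
        linear_combination b * h3' + h
  · have a2 : a ^ 2 = -1 := h3.resolve_right h3'
    by_cases hc : c * b = 1
    · right
      refine ⟨b, ?_⟩
      rw [aux_prim8]
      have hab : a = b ^ 2 := by
        rcases s1.2 with h | h
        · have e1 : b ^ 2 * a ^ 9 = -1 := by linear_combination h - b ^ 2 * a ^ 9 * hc
          have e2 : a ^ 10 = -1 := by
            rw [show a ^ 10 = (a ^ 2) ^ 5 by ring, a2]; norm_num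
          linear_combination a * e1 - b ^ 2 * e2
        · exfalso; apply h3'
          field_simp at h
          linear_combination h - a ^ 3 * b * hc
      refine ⟨by rw [← a2, hab]; ring, Or.inl ⟨hab, rfl, eq_inv_of_mul_eq_one_left hc⟩⟩
    · obtain rfl : c = -1 := h1.resolve_right hc
      right
      have hab : a * b ^ 2 = 1 := by
        rcases s2.1 with h | h
        · exfalso
          have hb2 : (b - 1) * (b + 1) = 0 := by linear_combination -h + b ^ 2 * a2
          rcases mul_eq_zero.1 hb2 with h | h
          · exact n0 (sub_eq_zero.1 h)
          · apply n4; linear_combination b * a2 - h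
        · field_simp at h
          linear_combination h + a * b ^ 2 * a2
      have b2 : b ^ 2 = -a := by linear_combination -a * hab + b ^ 2 * a2
      have b4 : b ^ 4 = -1 := by linear_combination (b ^ 2 - a) * b2 + a2
      refine ⟨b ^ 3, ?_⟩
      rw [aux_prim8]
      refine ⟨by linear_combination (b ^ 8 - b ^ 4 + 1) * b4, Or.inr (Or.inl ⟨?_, ?_, rfl⟩)⟩
      · linear_combination b2 - b ^ 2 * b4
      · linear_combination -b * (b ^ 4 - 1) * b4

theorem aux_mVal3 {q : Fin 2 → Fin 2 → k} {F : Fin 2 → Fin 2 → ℤ} {i j : Fin 2} :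
    mVal q F i j = 3 ↔ M3 (chiOf q (F i) (F i)) (chiOf q (F i) (F j) * chiOf q (F j) (F i)) := by
  have hm : ∀ m, m ∈ mSet q F i j ↔ (qnum (chiOf q (F i) (F i)) (m + 1) = 0 ∨
      (chiOf q (F i) (F i)) ^ m * (chiOf q (F i) (F j) * chiOf q (F j) (F i)) = 1) := by
    intro m
    rw [mSet, Set.mem_ofPred_eq, mul_eq_zero, sub_eq_zero, mul_assoc]
  have key : mVal q F i j = 3 ↔ 3 ∈ mSet q F i j ∧ 0 ∉ mSet q F i j ∧ 1 ∉ mSet q F i j ∧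
      2 ∉ mSet q F i j := by
    unfold mVal
    constructor
    · intro h
      refine ⟨?_, ?_, ?_, ?_⟩
      · have hne : (mSet q F i j).Nonempty := Nat.nonempty_of_pos_sInf (by omega)
        have := Nat.sInf_mem hne
        rwa [h] at this
      all_goals exact Nat.notMem_of_lt_sInf (by omega)
    · rintro ⟨h3, h0, h1, h2⟩
      have hle := Nat.sInf_le h3
      have hmem := Nat.sInf_mem ⟨3, h3⟩
      generalize sInf (mSet q F i j) = n at *
      interval_cases n <;> first | rfl | contradiction
  rw [key]
  simp only [hm, qnum, Finset.sum_range_succ, Finset.sum_range_zero, M3]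
  generalize chiOf q (F i) (F i) = a
  generalize chiOf q (F i) (F j) * chiOf q (F j) (F i) = b
  have e1 : (1 + a = 0) ↔ a = -1 := ⟨fun h => by linear_combination h, fun h => by rw [h]; ring⟩
  have e3 : 1 + a + a ^ 2 + a ^ 3 = 0 ↔ (a = -1 ∨ a ^ 2 = -1) := by
    rw [show 1 + a + a ^ 2 + a ^ 3 = (a - -1) * (a ^ 2 - -1) by ring, mul_eq_zero, sub_eq_zero,
      sub_eq_zero]
  simp only [zero_add, pow_zero, pow_one, one_mul, e1, e3, Nat.reduceAdd, one_ne_zero, false_or,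
    not_or, Finset.sum_range_succ, Finset.sum_range_zero]
  tauto

theorem aux_mVal1 {q : Fin 2 → Fin 2 → k} {F : Fin 2 → Fin 2 → ℤ} {i j : Fin 2} :
    mVal q F i j = 1 ↔ M1 (chiOf q (F i) (F j) * chiOf q (F j) (F i)) (chiOf q (F i) (F i)) := by
  have hm : ∀ m, m ∈ mSet q F i j ↔ (qnum (chiOf q (F i) (F i)) (m + 1) = 0 ∨
      (chiOf q (F i) (F i)) ^ m * (chiOf q (F i) (F j) * chiOf q (F j) (F i)) = 1) := by
    intro m
    rw [mSet, Set.mem_ofPred_eq, mul_eq_zero, sub_eq_zero, mul_assoc]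
  have key : mVal q F i j = 1 ↔ 1 ∈ mSet q F i j ∧ 0 ∉ mSet q F i j := by
    unfold mVal
    constructor
    · intro h
      refine ⟨?_, ?_⟩
      · have hne : (mSet q F i j).Nonempty := Nat.nonempty_of_pos_sInf (by omega)
        have := Nat.sInf_mem hne
        rwa [h] at this
      all_goals exact Nat.notMem_of_lt_sInf (by omega)
    · rintro ⟨h3, h0⟩
      have hle := Nat.sInf_le h3
      have hmem := Nat.sInf_mem ⟨1, h3⟩
      generalize sInf (mSet q F i j) = n at *
      interval_cases n <;> first | rfl | contradiction
  rw [key]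
  simp only [hm, qnum, Finset.sum_range_succ, Finset.sum_range_zero, M1]
  generalize chiOf q (F i) (F i) = a
  generalize chiOf q (F i) (F j) * chiOf q (F j) (F i) = b
  have e1 : (1 + a = 0) ↔ a = -1 := ⟨fun h => by linear_combination h, fun h => by rw [h]; ring⟩
  simp only [zero_add, pow_zero, pow_one, one_mul, e1, Nat.reduceAdd, one_ne_zero, false_or,
    not_or]
  tauto

/-- a predicate of the diagonal data of `F` -/
def TT (q : Fin 2 → Fin 2 → k) (F : Fin 2 → Fin 2 → ℤ) (R : k → k → k → Prop) : Prop :=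
  R (chiOf q (F 0) (F 0)) (chiOf q (F 0) (F 1) * chiOf q (F 1) (F 0)) (chiOf q (F 1) (F 1))

theorem aux_mVals {q : Fin 2 → Fin 2 → k} {F : Fin 2 → Fin 2 → ℤ} :
    (mVal q F 0 1 = 3 ∧ mVal q F 1 0 = 1) ↔ TT q F (fun a b c => M3 a b ∧ M1 b c) := by
  rw [aux_mVal3, aux_mVal1, TT, mul_comm (chiOf q (F 1) (F 0))]

theorem aux_T1 {q : Fin 2 → Fin 2 → k} (hq : ∀ i j, q i j ≠ 0) {F : Fin 2 → Fin 2 → ℤ}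
    (h : mVal q F 0 1 = 3) (R : k → k → k → Prop) :
    TT q (reflectBasis q F 0) R ↔
      TT q F (fun a b c => R a ((a ^ 6)⁻¹ * b⁻¹) (c * b ^ 3 * a ^ 9)) := by
  have r0 : reflectBasis q F 0 0 = -F 0 := by simp [reflectBasis]
  have r1 : reflectBasis q F 0 1 = F 1 + (F 0 + F 0 + F 0) := by
    simp only [reflectBasis, h]
    funext x; simp; ring
  have h00 := aux_chi_ne hq (F 0) (F 0)
  have h01 := aux_chi_ne hq (F 0) (F 1)
  have h10 := aux_chi_ne hq (F 1) (F 0)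
  rw [TT, TT, r0, r1]
  simp only [aux_chi_add_left hq, aux_chi_add_right hq, aux_chi_neg_left, aux_chi_neg_right]
  apply iff_of_eq
  congr 1
  · simp
  · field_simp
  · ring

theorem aux_T2 {q : Fin 2 → Fin 2 → k} (hq : ∀ i j, q i j ≠ 0) {F : Fin 2 → Fin 2 → ℤ}
    (h : mVal q F 1 0 = 1) (R : k → k → k → Prop) :
    TT q (reflectBasis q F 1) R ↔
      TT q F (fun a b c => R (a * b * c) (b⁻¹ * (c ^ 2)⁻¹) c) := by
  have r0 : reflectBasis q F 1 1 = -F 1 := by simp [reflectBasis]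
  have r1 : reflectBasis q F 1 0 = F 0 + F 1 := by
    simp only [reflectBasis, h]
    funext x; simp
  have h00 := aux_chi_ne hq (F 1) (F 1)
  have h01 := aux_chi_ne hq (F 0) (F 1)
  have h10 := aux_chi_ne hq (F 1) (F 0)
  rw [TT, TT, r0, r1]
  simp only [aux_chi_add_left hq, aux_chi_add_right hq, aux_chi_neg_left, aux_chi_neg_right]
  apply iff_of_eq
  congr 1
  · ring
  · field_simp
  · simp

theorem aux_can {q : Fin 2 → Fin 2 → k} (R : k → k → k → Prop) :
    TT q canBasis R ↔ R (q 0 0) (q 0 1 * q 1 0) (q 1 1) := by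
  simp [TT, chiOf, canBasis, Fin.prod_univ_two]

theorem aux_mDef {q : Fin 2 → Fin 2 → k} {F : Fin 2 → Fin 2 → ℤ} {i j : Fin 2}
    (h : 0 < mVal q F i j) : mDef q F i j := Nat.nonempty_of_pos_sInf h

theorem aux_orbit [CharZero k] {q : Fin 2 → Fin 2 → k} (hq : ∀ i j, q i j ≠ 0)
    (h : TT q canBasis PP) {F : Fin 2 → Fin 2 → ℤ} (hF : InWeylOrbit q F) : TT q F PP := by
  induction hF with
  | base => exact h
  | step F i _ _ ih =>
    have hv := aux_mVals.2 (show TT q F (fun a b c => M3 a b ∧ M1 b c) from aux_P_M3 ih)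
    fin_cases i
    · exact (aux_T1 hq hv.1 _).2 (aux_P_s1 ih)
    · exact (aux_T2 hq hv.2 _).2 (aux_P_s2 ih)

theorem aux_main [CharZero k] (q : Fin 2 → Fin 2 → k) (hq : ∀ i j, q i j ≠ 0) :
    (IsStandard q ∧ mVal q canBasis 0 1 = 3 ∧ mVal q canBasis 1 0 = 1) ↔
      PP (q 0 0) (q 0 1 * q 1 0) (q 1 1) := by
  rw [← aux_can (q := q) PP]
  constructor
  · rintro ⟨⟨_, hs⟩, h01, h10⟩
    have hb := hs canBasis InWeylOrbit.base
    have m := aux_mVals.1 ⟨h01, h10⟩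
    have m1 := aux_mVals.1 ⟨(hb 0 0 1 (by decide)).trans h01, (hb 0 1 0 (by decide)).trans h10⟩
    have m2 := aux_mVals.1 ⟨(hb 1 0 1 (by decide)).trans h01, (hb 1 1 0 (by decide)).trans h10⟩
    rw [aux_T1 hq h01] at m1
    rw [aux_T2 hq h10] at m2
    exact aux_class (aux_chi_ne hq _ _) (mul_ne_zero (aux_chi_ne hq _ _) (aux_chi_ne hq _ _))
      m.1 m.2 m1.2 m2.1
  · intro h
    have hv : ∀ F, InWeylOrbit q F → mVal q F 0 1 = 3 ∧ mVal q F 1 0 = 1 := fun F hF =>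
      aux_mVals.2 (aux_P_M3 (aux_orbit hq h hF))
    have hd : ∀ F, InWeylOrbit q F → ∀ i j : Fin 2, i ≠ j → mDef q F i j := by
      intro F hF i j hij
      obtain ⟨h1, h2⟩ := hv F hF
      apply aux_mDef
      fin_cases i <;> fin_cases j <;> simp_all
    refine ⟨⟨hd, ?_⟩, hv _ InWeylOrbit.base⟩
    intro F hF l i j hij
    obtain ⟨h1, h2⟩ := hv F hF
    obtain ⟨h3, h4⟩ := hv _ (InWeylOrbit.step F l hF fun j hj => hd F hF l j hj.symm)
    fin_cases i <;> fin_cases j <;> simp_all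

end Helpers

/-- Classification of standard braidings of type `G_2` (with `m_{12} = 3`, `m_{21} = 1`). -/
theorem stmt_3 {k : Type*} [Field k] [IsAlgClosed k] [CharZero k]
    (q : Fin 2 → Fin 2 → k) (hq : ∀ i j, q i j ≠ 0) :
    (IsStandard q ∧ mVal q canBasis 0 1 = 3 ∧ mVal q canBasis 1 0 = 1) ↔
      -- (a) Cartan type: q₁₁ = p, q₁₂q₂₁ = p⁻³, q₂₂ = p³, with p either not a root of
      -- unity or a root of unity of order ≥ 4
      ((∃ p : k, p ≠ 0 ∧ (∀ n : ℕ, 0 < n → p ^ n = 1 → 4 ≤ n) ∧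
          q 0 0 = p ∧ q 0 1 * q 1 0 = (p ^ 3)⁻¹ ∧ q 1 1 = p ^ 3) ∨
      -- (b) ζ a primitive eighth root of unity
      (∃ ζ : k, IsPrimitiveRoot ζ 8 ∧
          ((q 0 0 = ζ ^ 2 ∧ q 0 1 * q 1 0 = ζ ∧ q 1 1 = ζ⁻¹) ∨
           (q 0 0 = ζ ^ 2 ∧ q 0 1 * q 1 0 = ζ ^ 3 ∧ q 1 1 = -1) ∨
           (q 0 0 = ζ ∧ q 0 1 * q 1 0 = ζ ^ 5 ∧ q 1 1 = -1)))) := by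
  exact aux_main q hq
end

section
/- With the standard type A_θ hypotheses on (q_{st}) and the listed relations holding in the ℤ^θ-graded algebra B: for all indices 1 ≤ i ≤ j < p ≤ r ≤ θ one has (1) [x_{u_{ij}}, x_{u_{pr}}]_c = 0 whenever p − j ≥ 2, and (2) [x_{u_{ij}}, x_{u_{j+1,r}}]_c = x_{u_{ir}}. -/
/-- The degree `e_i ∈ ℤ^θ` of the generator `x_i` (indices are 1-based, degrees are
modeled as finitely supported-looking functions `ℕ → ℤ`). -/
def evec (i : ℕ) : ℕ → ℤ := fun t => if t = i then 1 else 0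

/-- The degree `u_{ij} = e_i + e_{i+1} + ⋯ + e_j ∈ ℤ^θ`. -/
def uvec (i j : ℕ) : ℕ → ℤ := fun t => if i ≤ t ∧ t ≤ j then 1 else 0

/-- Braided commutator of (homogeneous) elements `u, v` of degrees `α, β`:
`[u, v]_c = uv − χ(α, β) vu`. -/
def bra {k : Type*} [Field k] {B : Type*} [Ring B] [Algebra k B]
    (χ : (ℕ → ℤ) → (ℕ → ℤ) → k) (α : ℕ → ℤ) (u : B) (β : ℕ → ℤ) (v : B) : B :=
  u * v - χ α β • (v * u)

/-- The iterated root vector `x_{u_{ij}}`, defined by `x_{u_{ii}} = x_i` and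
`x_{u_{ij}} = [x_i, x_{u_{i+1,j}}]_c` for `i < j`. -/
def xu {k : Type*} [Field k] {B : Type*} [Ring B] [Algebra k B]
    (χ : (ℕ → ℤ) → (ℕ → ℤ) → k) (x : ℕ → B) (i j : ℕ) : B :=
  if h : j ≤ i then x i
  else bra χ (evec i) (x i) (uvec (i + 1) j) (xu χ x (i + 1) j)
termination_by j - i
decreasing_by omega

theorem bra_jac {k : Type*} [Field k] {B : Type*} [Ring B] [Algebra k B]
    (χ : (ℕ → ℤ) → (ℕ → ℤ) → k)
    (hχ₁ : ∀ a b c, χ (a + b) c = χ a c * χ b c)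
    (hχ₂ : ∀ a b c, χ a (b + c) = χ a b * χ a c)
    (α β γ : ℕ → ℤ) (u v w : B) :
    bra χ (α + β) (bra χ α u β v) γ w = bra χ α u (β + γ) (bra χ β v γ w)
      - χ α β • (v * bra χ α u γ w) + χ β γ • (bra χ α u γ w * v) := by
  unfold bra
  rw [hχ₁, hχ₂]
  simp only [mul_sub, sub_mul, smul_sub, smul_mul_assoc, mul_smul_comm, smul_smul, mul_assoc]
  rw [mul_comm (χ β γ) (χ α γ), show χ α γ * (χ β γ * χ α β) = χ α β * (χ α γ * χ β γ) by ring]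
  abel

theorem uvec_self (i : ℕ) : uvec i i = evec i := by
  funext t
  simp only [uvec, evec]
  congr 1
  exact propext ⟨fun h => by omega, fun h => by omega⟩

theorem uvec_cons (i j : ℕ) (h : i ≤ j) : evec i + uvec (i + 1) j = uvec i j := by
  funext t
  simp only [uvec, evec, Pi.add_apply]
  split_ifs <;> omega

theorem uvec_app (i j r : ℕ) (h : i ≤ j + 1) (h' : j ≤ r) :
    uvec i j + uvec (j + 1) r = uvec i r := by
  funext t
  simp only [uvec, Pi.add_apply]
  split_ifs <;> omega

theorem xu_self {k : Type*} [Field k] {B : Type*} [Ring B] [Algebra k B]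
    (χ : (ℕ → ℤ) → (ℕ → ℤ) → k) (x : ℕ → B) (i : ℕ) : xu χ x i i = x i := by
  rw [xu]; simp

theorem xu_cons {k : Type*} [Field k] {B : Type*} [Ring B] [Algebra k B]
    (χ : (ℕ → ℤ) → (ℕ → ℤ) → k) (x : ℕ → B) (i j : ℕ) (h : i < j) :
    xu χ x i j = bra χ (evec i) (x i) (uvec (i + 1) j) (xu χ x (i + 1) j) := by
  rw [xu, dif_neg (by omega)]

/-- Lemma: `[x_{u_{ij}}, x_{u_{pr}}]_c = 0` if `p − j ≥ 2`, and
`[x_{u_{ij}}, x_{u_{j+1,r}}]_c = x_{u_{ir}}`, for `1 ≤ i ≤ j < p ≤ r ≤ θ`. -/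
theorem stmt_5 {k : Type*} [Field k] {B : Type*} [Ring B] [Algebra k B]
    -- the braiding matrix, of standard type A_θ
    (θ : ℕ) (hθ : 2 ≤ θ) (q : ℕ → ℕ → k) (q0 : k) (hq00 : q0 ≠ 0) (hq01 : q0 ≠ 1)
    (hq : ∀ s t, 1 ≤ s → s ≤ θ → 1 ≤ t → t ≤ θ → q s t ≠ 0)
    (hfar : ∀ s t, 1 ≤ s → s ≤ θ → 1 ≤ t → t ≤ θ → (s + 1 < t ∨ t + 1 < s) →
      q s t * q t s = 1)
    (hadjt : ∀ s, 1 ≤ s → s + 1 ≤ θ →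
      q s (s + 1) * q (s + 1) s = q0 ∨ q s (s + 1) * q (s + 1) s = q0⁻¹)
    (hdiag : ∀ s, 1 ≤ s → s ≤ θ →
      (q s s = -1 ∧ (1 < s → s < θ →
          (q (s - 1) s * q s (s - 1)) * (q s (s + 1) * q (s + 1) s) = 1)) ∨
      (q s s ≠ -1 ∧ (q s s = q0 ∨ q s s = q0⁻¹) ∧
        (s < θ → q s s * (q s (s + 1) * q (s + 1) s) = 1) ∧
        (1 < s → q s s * (q (s - 1) s * q s (s - 1)) = 1)))
    -- the associated bicharacter
    (χ : (ℕ → ℤ) → (ℕ → ℤ) → k)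
    (hχ₁ : ∀ a b c, χ (a + b) c = χ a c * χ b c)
    (hχ₂ : ∀ a b c, χ a (b + c) = χ a b * χ a c)
    (hχq : ∀ s t, 1 ≤ s → s ≤ θ → 1 ≤ t → t ≤ θ → χ (evec s) (evec t) = q s t)
    -- the ℤ^θ-graded algebra B with its generators x_i of degree e_i
    (x : ℕ → B) (𝒜 : (ℕ → ℤ) → Submodule k B)
    (hgr : ∀ (α β : ℕ → ℤ) (a b : B), a ∈ 𝒜 α → b ∈ 𝒜 β → a * b ∈ 𝒜 (α + β))
    (hxdeg : ∀ i, 1 ≤ i → i ≤ θ → x i ∈ 𝒜 (evec i))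
    -- the relations assumed to hold in B
    (hnil : ∀ i, 1 ≤ i → i ≤ θ → q i i = -1 → x i ^ 2 = 0)
    (hrel1 : ∀ i j, 1 ≤ i → i ≤ θ → 1 ≤ j → j ≤ θ → (i + 1 < j ∨ j + 1 < i) →
      bra χ (evec i) (x i) (evec j) (x j) = 0)
    (hrel2 : ∀ i j, 1 ≤ i → i ≤ θ → 1 ≤ j → j ≤ θ → (i + 1 = j ∨ j + 1 = i) →
      bra χ (evec i) (x i) (evec i + evec j) (bra χ (evec i) (x i) (evec j) (x j)) = 0)
    (hrel3 : ∀ i, 1 ≤ i → i + 2 ≤ θ →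
      bra χ (evec i + (evec (i + 1) + evec (i + 2)))
        (bra χ (evec i) (x i) (evec (i + 1) + evec (i + 2))
          (bra χ (evec (i + 1)) (x (i + 1)) (evec (i + 2)) (x (i + 2))))
        (evec (i + 1)) (x (i + 1)) = 0) :
    ∀ i j p r, 1 ≤ i → i ≤ j → j < p → p ≤ r → r ≤ θ →
      (j + 2 ≤ p → bra χ (uvec i j) (xu χ x i j) (uvec p r) (xu χ x p r) = 0) ∧
      (p = j + 1 → bra χ (uvec i j) (xu χ x i j) (uvec p r) (xu χ x p r) = xu χ x i r) := by
  have z1 : ∀ (a b : ℕ → ℤ) (u : B), bra χ a u b 0 = 0 := by intros; simp [bra]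
  have jac := bra_jac (B := B) χ hχ₁ hχ₂
  have A : ∀ n i p r, r - p = n → 1 ≤ i → i + 2 ≤ p → p ≤ r → r ≤ θ →
      bra χ (evec i) (x i) (uvec p r) (xu χ x p r) = 0 := by
    intro n
    induction n with
    | zero =>
      intro i p r h1 h2 h3 h4 h5
      obtain rfl : p = r := by omega
      rw [xu_self, uvec_self]
      exact hrel1 i p (by omega) (by omega) (by omega) (by omega) (by omega)
    | succ n ih =>
      intro i p r h1 h2 h3 h4 h5
      have e1 := hrel1 i p (by omega) (by omega) (by omega) (by omega) (by omega)
      have e2 := ih i (p + 1) r (by omega) (by omega) (by omega) (by omega) (by omega)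
      have e3 := jac (evec i) (evec p) (uvec (p + 1) r) (x i) (x p) (xu χ x (p + 1) r)
      rw [e1, e2, ← xu_cons χ x p r (by omega), uvec_cons p r h4] at e3
      have e4 : ∀ (a b : ℕ → ℤ) (u : B), bra χ a 0 b u = 0 := by intros; simp [bra]
      simpa [e4] using e3.symm
  have C : ∀ n i j p r, j - i = n → 1 ≤ i → i ≤ j → j + 2 ≤ p → p ≤ r → r ≤ θ →
      bra χ (uvec i j) (xu χ x i j) (uvec p r) (xu χ x p r) = 0 := by
    intro n
    induction n with
    | zero =>
      intro i j p r h1 h2 h3 h4 h5 h6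
      obtain rfl : i = j := by omega
      rw [xu_self, uvec_self]
      exact A _ i p r rfl h2 h4 h5 h6
    | succ n ih =>
      intro i j p r h1 h2 h3 h4 h5 h6
      have e1 := A _ i p r rfl h2 (by omega) h5 h6
      have e2 := ih (i + 1) j p r (by omega) (by omega) (by omega) h4 h5 h6
      have e3 := jac (evec i) (uvec (i + 1) j) (uvec p r) (x i) (xu χ x (i + 1) j) (xu χ x p r)
      rw [e1, e2, ← xu_cons χ x i j (by omega), uvec_cons i j h3, z1] at e3
      simpa using e3
  have D : ∀ n i j r, j - i = n → 1 ≤ i → i ≤ j → j + 1 ≤ r → r ≤ θ →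
      bra χ (uvec i j) (xu χ x i j) (uvec (j + 1) r) (xu χ x (j + 1) r) = xu χ x i r := by
    intro n
    induction n with
    | zero =>
      intro i j r h1 h2 h3 h5 h6
      obtain rfl : i = j := by omega
      rw [xu_self, uvec_self, xu_cons χ x i r (by omega)]
    | succ n ih =>
      intro i j r h1 h2 h3 h5 h6
      have e1 := A _ i (j + 1) r rfl h2 (by omega) h5 h6
      have e2 := ih (i + 1) j r (by omega) (by omega) (by omega) h5 h6
      have e3 := jac (evec i) (uvec (i + 1) j) (uvec (j + 1) r) (x i) (xu χ x (i + 1) j)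
        (xu χ x (j + 1) r)
      rw [e1, e2, ← xu_cons χ x i j (by omega), uvec_cons i j h3,
        uvec_app (i + 1) j r (by omega) (by omega), ← xu_cons χ x i r (by omega)] at e3
      simpa using e3
  intro i j p r h1 h2 h3 h4 h5
  refine ⟨fun h => C _ i j p r rfl h1 h2 h h4 h5, ?_⟩
  rintro rfl
  exact D _ i j r rfl h1 h2 h4 h5
end

section
/- (Lyndon's theorem) Every nonempty word u over a totally ordered finite alphabet admits a unique decomposition u = l_1 l_2 ⋯ l_r as a product of non-increasing Lyndon words, i.e. with l_i Lyndon for all i and l_r ≤ ⋯ ≤ l_2 ≤ l_1 in the lexicographic order. -/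
/-- A nonempty word `u` over a totally ordered alphabet is a Lyndon word if it is
lexicographically smaller than each of its proper nonempty ends. -/
def IsLyndon {α : Type*} [LinearOrder α] (u : List α) : Prop :=
  u ≠ [] ∧ ∀ v w : List α, v ≠ [] → w ≠ [] → u = v ++ w → u < w

theorem lyn_lt_app {α : Type*} [LinearOrder α] (w : List α) {a b : List α} (h : a < b) :
    w ++ a < w ++ b := List.Lex.append_left _ h w

theorem lyn_le_app {α : Type*} [LinearOrder α] (u v : List α) : u ≤ u ++ v := by
  rcases v with _ | ⟨a, v⟩
  · simp
  · have h : ([] : List α) < a :: v := List.Lex.nil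
    have := lyn_lt_app u h
    rw [List.append_nil] at this
    exact this.le

theorem lyn_dich {α : Type*} [LinearOrder α] (u v : List α) (h : u < v) :
    (∃ t, v = u ++ t) ∨ ∀ s t, u ++ s < v ++ t := by
  induction h with
  | nil => left; exact ⟨_, rfl⟩
  | rel h => right; intro s t; exact List.Lex.rel h
  | cons h ih =>
    rcases ih with ⟨t, rfl⟩ | ih
    · left; exact ⟨t, rfl⟩
    · right; intro s t; exact List.Lex.cons (ih s t)

theorem lyn_mul {α : Type*} [LinearOrder α] (u v : List α) (hu : IsLyndon u) (hv : IsLyndon v)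
    (h : u < v) : IsLyndon (u ++ v) := by
  have key : u ++ v < v := by
    rcases lyn_dich u v h with ⟨t, ht⟩ | h'
    · have hne : t ≠ [] := by
        rintro rfl
        rw [List.append_nil] at ht
        subst ht
        exact lt_irrefl _ h
      have h1 := lyn_lt_app u (hv.2 u t hu.1 hne ht)
      rwa [← ht] at h1
    · simpa using h' v []
  refine ⟨by simp [hu.1], ?_⟩
  intro x w hx hw e
  rcases List.append_eq_append_iff.1 e with ⟨c, h1, h2⟩ | ⟨c, h1, h2⟩
  · rcases eq_or_ne c [] with rfl | hc
    · rw [List.nil_append] at h2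
      rw [← h2]; exact key
    · exact key.trans (hv.2 c w hc hw h2)
  · rcases eq_or_ne c [] with rfl | hc
    · rw [List.nil_append] at h2
      rw [h2]; exact key
    · rcases lyn_dich u c (hu.2 x c hx hc h1) with ⟨t, ht⟩ | h'
      · exfalso
        have e1 := congrArg List.length h1
        have e2 := congrArg List.length ht
        have := List.length_pos_iff.2 hx
        simp at e1 e2
        omega
      · rw [h2]; exact h' v v

theorem lyn_ins {α : Type*} [LinearOrder α] (L : List (List α)) : ∀ w : List α, IsLyndon w →
    (∀ w ∈ L, IsLyndon w) → L.IsChain (fun a b => b ≤ a) →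
    ∃ M : List (List α), w ++ L.flatten = M.flatten ∧ (∀ w ∈ M, IsLyndon w) ∧
      M.IsChain (fun a b => b ≤ a) := by
  induction L with
  | nil => intro w hw _ _; exact ⟨[w], by simp, by simpa using hw, by simp⟩
  | cons l L ih =>
    intro w hw hL hc
    rcases le_or_gt l w with h | h
    · refine ⟨w :: l :: L, by simp, ?_, ?_⟩
      · intro x hx
        rcases List.mem_cons.1 hx with rfl | hx
        · exact hw
        · exact hL x hx
      · exact List.isChain_cons_cons.2 ⟨h, hc⟩
    · obtain ⟨M, h1, h2⟩ := ih (w ++ l) (lyn_mul w l hw (hL l (by simp)) h)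
        (fun x hx => hL x (by simp [hx])) hc.tail
      exact ⟨M, by rw [← h1]; simp, h2⟩

theorem lyn_ex {α : Type*} [LinearOrder α] (u : List α) :
    ∃ M : List (List α), u = M.flatten ∧ (∀ w ∈ M, IsLyndon w) ∧
      M.IsChain (fun a b => b ≤ a) := by
  induction u with
  | nil => exact ⟨[], by simp, by simp, by simp⟩
  | cons a u ih =>
    obtain ⟨L, rfl, h1, h2⟩ := ih
    refine lyn_ins L [a] ⟨by simp, ?_⟩ h1 h2
    intro v w hv hw e
    have e1 := congrArg List.length e
    have := List.length_pos_iff.2 hv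
    have := List.length_pos_iff.2 hw
    simp at e1
    omega

theorem lyn_suf {α : Type*} [LinearOrder α] (m : List α) (M : List (List α)) :
    ∀ r s : List α, r ≠ [] → r ++ s = M.flatten → (∀ x ∈ M, x ≤ m) →
    ∃ q p : List α, r = q ++ p ∧ p ≠ [] ∧ p ≤ m := by
  induction M with
  | nil => intro r s hr e; simp [hr] at e
  | cons x M ih =>
    intro r s hr e hM
    have hx : x ≤ m := hM x (by simp)
    rw [List.flatten_cons] at e
    rcases List.append_eq_append_iff.1 e with ⟨c, h1, h2⟩ | ⟨c, h1, h2⟩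
    · exact ⟨[], r, by simp, hr, (h1 ▸ lyn_le_app r c : r ≤ x).trans hx⟩
    · rcases eq_or_ne c [] with rfl | hc
      · rw [List.append_nil] at h1
        exact ⟨[], r, by simp, hr, h1 ▸ hx⟩
      · obtain ⟨q, p, h3, h4⟩ := ih c s hc h2.symm (fun y hy => hM y (by simp [hy]))
        exact ⟨x ++ q, p, by rw [h1, h3]; simp, h4⟩

theorem lyn_head {α : Type*} [LinearOrder α] (l m c s : List α) (M : List (List α))
    (hl : IsLyndon l) (hm : IsLyndon m) (h1 : l = m ++ c) (h2 : M.flatten = c ++ s)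
    (hM : ∀ x ∈ M, x ≤ m) : c = [] := by
  by_contra hc
  obtain ⟨q, p, h3, h4, h5⟩ := lyn_suf m M c s hc h2.symm hM
  have := hl.2 (m ++ q) p (by simp [hm.1]) h4 (by rw [h1, h3]; simp)
  have h6 : m ≤ l := h1 ▸ lyn_le_app m c
  exact absurd (this.trans_le (h5.trans h6)) (lt_irrefl _)

theorem lyn_uniq {α : Type*} [LinearOrder α] (L : List (List α)) : ∀ M : List (List α),
    L.flatten = M.flatten → (∀ w ∈ L, IsLyndon w) → (∀ w ∈ M, IsLyndon w) →
    L.Pairwise (fun a b => b ≤ a) → M.Pairwise (fun a b => b ≤ a) → L = M := by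
  induction L with
  | nil =>
    intro M e _ hM _ _
    rcases M with _ | ⟨m, M⟩
    · rfl
    · have := (hM m (by simp)).1
      simp [this] at e
  | cons l L ih =>
    intro M e hL hM pL pM
    rcases M with _ | ⟨m, M⟩
    · have := (hL l (by simp)).1
      simp [this] at e
    · have hl := hL l (by simp)
      have hm := hM m (by simp)
      rw [List.pairwise_cons] at pL pM
      rw [List.flatten_cons, List.flatten_cons] at e
      have hlm : l = m := by
        rcases List.append_eq_append_iff.1 e with ⟨c, h1, h2⟩ | ⟨c, h1, h2⟩
        · have := lyn_head m l c _ L hm hl h1 h2 pL.1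
          simp [h1, this]
        · have := lyn_head l m c _ M hl hm h1 h2 pM.1
          simp [h1, this]
      subst hlm
      rw [ih M (List.append_cancel_left e) (fun x hx => hL x (by simp [hx]))
        (fun x hx => hM x (by simp [hx])) pL.2 pM.2]

/-- Lyndon's theorem: every nonempty word has a unique decomposition as a product of
non-increasing Lyndon words. -/
theorem stmt_16 {α : Type*} [LinearOrder α] [Fintype α] (u : List α) (hu : u ≠ []) :
    ∃! L : List (List α),
      u = L.flatten ∧ (∀ w ∈ L, IsLyndon w) ∧ L.Chain' (fun a b => b ≤ a) := by
  obtain ⟨M, h1, h2, h3⟩ := lyn_ex u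
  refine ⟨M, ⟨h1, h2, h3⟩, ?_⟩
  rintro L ⟨g1, g2, g3⟩
  have : IsTrans (List α) (fun a b => b ≤ a) := ⟨fun a b c h h' => h'.trans h⟩
  exact lyn_uniq L M (g1.symm.trans h1) g2 h2 (List.isChain_iff_pairwise.1 g3)
    (List.isChain_iff_pairwise.1 h3)
end

section
/- Let u, v, w be Lyndon words with u = vw. Then u = vw is the Shirshov decomposition of u (i.e. w is the lexicographically smallest proper nonempty end of u) if and only if either v is a single letter, or, writing v = v_1 v_2 for the Shirshov decomposition of v, one has w ≤ v_2 in the lexicographic order. -/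
/-- `u = v ++ w` is the Shirshov decomposition of `u`: `v, w` are nonempty and `w` is the
lexicographically smallest proper nonempty end (suffix) of `u`. -/
def IsShirshov {α : Type*} [LinearOrder α] (u v w : List α) : Prop :=
  u = v ++ w ∧ v ≠ [] ∧ w ≠ [] ∧
    ∀ w' : List α, w' ≠ [] → w' <:+ u → w' ≠ u → w ≤ w'

theorem aux_le_append {α : Type*} [LinearOrder α] (a b : List α) : a ≤ a ++ b := by
  induction a with
  | nil => exact not_lt.mp (by simp)
  | cons x a ih =>
    rw [← not_lt] at ih ⊢
    rw [List.cons_append, List.cons_lt_cons_iff]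
    simpa using ih

theorem aux_lt {α : Type*} [LinearOrder α] (x : List α) : ∀ a b : List α, a < b →
    (∃ c, b = a ++ c) ∨ a ++ x < b := by
  intro a
  induction a with
  | nil => intro b _; exact Or.inl ⟨b, rfl⟩
  | cons y a ih =>
    intro b hb
    cases b with
    | nil => simp at hb
    | cons z b =>
      rw [List.cons_lt_cons_iff] at hb
      rcases hb with h | ⟨rfl, h⟩
      · right
        rw [List.cons_append, List.cons_lt_cons_iff]
        exact Or.inl h
      · rcases ih b h with ⟨c, rfl⟩ | h'
        · exact Or.inl ⟨c, rfl⟩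
        · right
          rw [List.cons_append, List.cons_lt_cons_iff]
          exact Or.inr ⟨rfl, h'⟩

theorem aux_append_le {α : Type*} [LinearOrder α] (a b c : List α) (h : a ++ b ≤ a ++ c) :
    b ≤ c := by
  induction a with
  | nil => simpa using h
  | cons x a ih =>
    apply ih
    rw [← not_lt] at h ⊢
    rw [List.cons_append, List.cons_append, List.cons_lt_cons_iff] at h
    simpa using h

theorem aux_min {α : Type*} [LinearOrder α] (t : List α) (ht : t ≠ []) :
    ∃ m, m ≠ [] ∧ m <:+ t ∧ ∀ s, s ≠ [] → s <:+ t → m ≤ s := by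
  induction t with
  | nil => exact absurd rfl ht
  | cons x t ih =>
    by_cases h : t = []
    · subst h
      refine ⟨[x], by simp, List.suffix_rfl, ?_⟩
      intro s hs hsx
      rw [List.suffix_cons_iff] at hsx
      rcases hsx with rfl | h
      · exact le_rfl
      · exact absurd (List.suffix_nil.mp h) hs
    · obtain ⟨m, hm, hmt, hmin⟩ := ih h
      rcases le_total m (x :: t) with hle | hle
      · refine ⟨m, hm, hmt.trans (List.suffix_cons x t), ?_⟩
        intro s hs hsx
        rcases List.suffix_cons_iff.mp hsx with rfl | h
        · exact hle
        · exact hmin s hs h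
      · refine ⟨x :: t, by simp, List.suffix_rfl, ?_⟩
        intro s hs hsx
        rcases List.suffix_cons_iff.mp hsx with rfl | h
        · exact le_rfl
        · exact hle.trans (hmin s hs h)

theorem aux_lyndon {α : Type*} [LinearOrder α] {w s : List α} (hw : IsLyndon w) (hs : s ≠ [])
    (h : s <:+ w) : w ≤ s := by
  obtain ⟨p, rfl⟩ := h
  by_cases hp : p = []
  · subst hp; simp
  · exact (hw.2 p s hp hs rfl).le

theorem aux_suffix {α : Type*} {s v w : List α} (h : s <:+ v ++ w) :
    s <:+ w ∨ ∃ v', v' ≠ [] ∧ v' <:+ v ∧ s = v' ++ w := by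
  rcases List.suffix_or_suffix_of_suffix h (List.suffix_append v w) with h1 | ⟨p, rfl⟩
  · exact Or.inl h1
  · by_cases hp : p = []
    · subst hp; left; simp
    · right
      refine ⟨p, hp, ?_, rfl⟩
      obtain ⟨q, hq⟩ := h
      rw [← List.append_assoc] at hq
      exact ⟨q, List.append_cancel_right hq⟩

/-- Let `u = v ++ w` with `u, v, w` Lyndon. Then `u = vw` is the Shirshov decomposition of `u`
iff either `v` is a single letter, or else, if `v = v₁v₂` is the Shirshov decomposition of `v`,
then `w ≤ v₂`. -/
theorem stmt_18 {α : Type*} [LinearOrder α] [Fintype α] (u v w : List α)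
    (hu : IsLyndon u) (hv : IsLyndon v) (hw : IsLyndon w) (huvw : u = v ++ w) :
    IsShirshov u v w ↔
      (v.length = 1 ∨ ∃ v₁ v₂ : List α, IsShirshov v v₁ v₂ ∧ w ≤ v₂) := by
  subst huvw
  constructor
  · rintro ⟨-, hv0, hw0, hmin⟩
    cases v with
    | nil => exact absurd rfl hv0
    | cons x t =>
      by_cases ht : t = []
      · subst ht; left; rfl
      · right
        obtain ⟨m, hm, ⟨p, hp⟩, hmm⟩ := aux_min t ht
        refine ⟨x :: p, m, ⟨by simp [hp], by simp, hm, ?_⟩, ?_⟩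
        · intro s hs hsx hne
          rcases List.suffix_cons_iff.mp hsx with rfl | h
          · exact absurd rfl hne
          · exact hmm s hs h
        · have key : w ≤ m ++ w := by
            apply hmin
            · simp [hm]
            · exact ⟨x :: p, by simp [← hp]⟩
            · intro h
              have := congrArg List.length h
              simp [← hp] at this
              omega
          by_contra hlt
          rw [not_le] at hlt
          rcases aux_lt w m w hlt with ⟨c, hc⟩ | h
          · have hc0 : c ≠ [] := by
              rintro rfl
              rw [List.append_nil] at hc
              exact absurd hlt (by rw [hc]; exact lt_irrefl _)
            have h1 : w < c := hw.2 m c hm hc0 hc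
            have h2 : m ++ c ≤ m ++ w := by rw [← hc]; exact key
            exact absurd h1 (not_lt.mpr (aux_append_le _ _ _ h2))
          · exact absurd h (not_lt.mpr key)
  · intro h
    refine ⟨rfl, hv.1, hw.1, ?_⟩
    intro s hs hsu hne
    rcases aux_suffix hsu with h1 | ⟨v', hv', hsuf, rfl⟩
    · exact aux_lyndon hw hs h1
    · have hne' : v' ≠ v := by rintro rfl; exact hne rfl
      rcases h with h | ⟨v₁, v₂, hS, hle⟩
      · exfalso
        apply hne'
        apply hsuf.eq_of_length_le
        have := List.length_pos_iff.mpr hv'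
        omega
      · exact hle.trans ((hS.2.2.2 v' hv' hsuf hne').trans (aux_le_append _ _))
end

section
/- Let v be a nonempty word with Lyndon decomposition v = l_1 ⋯ l_r, and let u be a nonempty word. Then u < v in the lexicographic order if and only if either (i) the Lyndon decomposition of u is u = l_1 ⋯ l_i for some 1 ≤ i < r, or (ii) the Lyndon decomposition of u has the form u = l_1 ⋯ l_{i−1} l l'_{i+1} ⋯ l'_s for some 1 ≤ i ≤ r and s, where l, l'_{i+1}, …, l'_s are Lyndon words and l < l_i. -/
theorem aux_app {α : Type*} [LinearOrder α] (a : List α) {x y : List α} :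
    a ++ x < a ++ y ↔ x < y := by
  induction a with
  | nil => simp
  | cons c a ih => simp [List.cons_lt_cons_iff, ih]

theorem aux_cases {α : Type*} [LinearOrder α] (a : List α) : ∀ b : List α, a < b →
    (∃ t, t ≠ [] ∧ b = a ++ t) ∨ ∀ x y, a ++ x < b ++ y := by
  induction a with
  | nil =>
    intro b h
    left
    refine ⟨b, ?_, rfl⟩
    rintro rfl
    exact lt_irrefl _ h
  | cons c a ih =>
    intro b h
    cases b with
    | nil => simp at h
    | cons d b =>
      rw [List.cons_lt_cons_iff] at h
      rcases h with h | ⟨rfl, h⟩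
      · right
        intro x y
        simp only [List.cons_append, List.cons_lt_cons_iff]
        exact Or.inl h
      · rcases ih b h with ⟨t, ht, rfl⟩ | h'
        · exact Or.inl ⟨t, ht, rfl⟩
        · right
          intro x y
          simp only [List.cons_append, List.cons_lt_cons_iff]
          right; simpa using h' x y

theorem aux_nil_lt {α : Type*} [LinearOrder α] (a : List α) (h : a ≠ []) : [] < a := by
  cases a with
  | nil => exact absurd rfl h
  | cons c a => simp

theorem aux_key {α : Type*} [LinearOrder α] (l : List α) (hl : IsLyndon l)
    (R : List (List α)) (hR : ∀ m ∈ R, m < l) :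
    ∀ p t s : List α, t ≠ [] → l = p ++ t → R.flatten < t ++ s := by
  induction R with
  | nil =>
    intro p t s ht _
    exact aux_nil_lt _ (by simp [ht])
  | cons m R ih =>
    intro p t s ht hp
    have hlt : l ≤ t := by
      by_cases h : p = []
      · subst h; simp at hp; exact le_of_eq hp
      · exact le_of_lt (hl.2 p t h ht hp)
    have hm : m < t := lt_of_lt_of_le (hR m (by simp)) hlt
    rw [List.flatten_cons]
    rcases aux_cases m t hm with ⟨t', ht', rfl⟩ | h
    · rw [List.append_assoc, aux_app]
      exact ih (fun m hm => hR m (by simp [hm])) (p ++ m) t' s ht' (by simp [hp])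
    · exact h _ _

theorem aux_mul {α : Type*} [LinearOrder α] (a b : List α) (ha : IsLyndon a)
    (hb : IsLyndon b) (hab : a < b) : IsLyndon (a ++ b) := by
  have h1 : a ++ b < b := by
    rcases aux_cases a b hab with ⟨t, ht, h⟩ | h
    · have := hb.2 a t ha.1 ht h
      have h2 := (aux_app a).2 this
      rwa [← h] at h2
    · simpa using h b []
  refine ⟨by simp [ha.1], ?_⟩
  intro v w hv hw h
  rcases List.append_eq_append_iff.1 h with ⟨c, rfl, h2⟩ | ⟨c, rfl, rfl⟩
  · by_cases hc : c = []
    · subst hc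
      simp at h2
      rwa [← h2]
    · exact h1.trans (hb.2 c w hc hw h2)
  · by_cases hc : c = []
    · subst hc
      simpa using h1
    · have h3 := ha.2 v c hv hc rfl
      rcases aux_cases _ _ h3 with ⟨t, ht, h4⟩ | h4
      · have h5 := congrArg List.length h4
        simp at h5
        have := List.length_pos_iff.2 hv
        omega
      · exact h4 _ _

theorem aux_ins {α : Type*} [LinearOrder α] (L : List (List α)) : ∀ (w : List α),
    IsLyndon w → (∀ x ∈ L, IsLyndon x) → L.IsChain (fun a b => b ≤ a) →
    ∃ M : List (List α), w ++ L.flatten = M.flatten ∧ (∀ x ∈ M, IsLyndon x) ∧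
      M.IsChain (fun a b => b ≤ a) := by
  induction L with
  | nil =>
    intro w hw _ _
    exact ⟨[w], by simp, by simpa using hw, by simp⟩
  | cons b L ih =>
    intro w hw hL hc
    by_cases h : b ≤ w
    · refine ⟨w :: b :: L, by simp, ?_, by simpa using ⟨h, hc⟩⟩
      intro x hx
      rcases List.mem_cons.1 hx with rfl | hx
      · exact hw
      · exact hL x hx
    · obtain ⟨M, h1, h2⟩ := ih (w ++ b) (aux_mul w b hw (hL b (by simp)) (not_le.1 h))
        (fun x hx => hL x (by simp [hx])) hc.tail
      exact ⟨M, by simpa using h1, h2⟩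

theorem aux_ex {α : Type*} [LinearOrder α] (u : List α) :
    ∃ M : List (List α), u = M.flatten ∧ (∀ x ∈ M, IsLyndon x) ∧
      M.IsChain (fun a b => b ≤ a) := by
  induction u with
  | nil => exact ⟨[], by simp⟩
  | cons x u ih =>
    obtain ⟨M, rfl, h2, h3⟩ := ih
    refine aux_ins M [x] ⟨by simp, ?_⟩ h2 h3
    intro v w hv hw h
    have h5 := congrArg List.length h
    simp at h5
    have := List.length_pos_iff.2 hv
    have := List.length_pos_iff.2 hw
    omega

theorem aux_lt_s19 {α : Type*} [LinearOrder α] (m l : List α) (R S : List (List α))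
    (hl : IsLyndon l) (hc : (m :: R).IsChain (fun a b => b ≤ a)) (h : m < l) :
    (m :: R).flatten < (l :: S).flatten := by
  have hp : (m :: R).Pairwise (fun a b => b ≤ a) := by
    have : IsTrans (List α) (fun a b => b ≤ a) := ⟨fun a b c h1 h2 => le_trans h2 h1⟩
    exact List.isChain_iff_pairwise.1 hc
  rw [List.flatten_cons (l := l)]
  refine aux_key l hl (m :: R) ?_ [] l _ hl.1 rfl
  intro x hx
  rcases List.mem_cons.1 hx with rfl | hx
  · exact h
  · exact lt_of_le_of_lt (List.rel_of_pairwise_cons hp hx) h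

theorem aux_main_s19 {α : Type*} [LinearOrder α] (M : List (List α)) : ∀ L : List (List α),
    (∀ w ∈ L, IsLyndon w) → L.IsChain (fun a b => b ≤ a) →
    (∀ w ∈ M, IsLyndon w) → M.IsChain (fun a b => b ≤ a) → M.flatten < L.flatten →
    ((∃ i : ℕ, i < L.length ∧ M = L.take i) ∨
         (∃ (i : ℕ) (hi : i < L.length) (l : List α) (rest : List (List α)),
            M = L.take i ++ l :: rest ∧ l < L.get ⟨i, hi⟩)) := by
  induction M with
  | nil =>
    intro L _ _ _ _ h
    left
    refine ⟨0, ?_, by simp⟩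
    rw [List.length_pos_iff]
    rintro rfl
    exact lt_irrefl _ h
  | cons m M ih =>
    intro L hL hLc hM hMc h
    cases L with
    | nil => simp at h
    | cons l L =>
      rcases lt_trichotomy m l with h1 | rfl | h1
      · exact Or.inr ⟨0, by simp, m, M, by simp, by simpa using h1⟩
      · rw [List.flatten_cons, List.flatten_cons, aux_app] at h
        rcases ih L (fun x hx => hL x (by simp [hx])) hLc.tail
          (fun x hx => hM x (by simp [hx])) hMc.tail h with ⟨i, hi, rfl⟩ | ⟨i, hi, k, rest, rfl, hk⟩
        · exact Or.inl ⟨i + 1, by simpa using hi, by simp⟩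
        · exact Or.inr ⟨i + 1, by simpa using hi, k, rest, by simp, by simpa using hk⟩
      · exact absurd h (lt_asymm (aux_lt_s19 l m L M (hM m (by simp)) hLc h1))

/-- Comparison of words via their Lyndon decompositions: if `v` has Lyndon decomposition
`v = l₁ ⋯ l_r`, then `u < v` iff the Lyndon decomposition of `u` is either a proper initial
segment `l₁ ⋯ l_i` (`1 ≤ i < r`), or is of the form `l₁ ⋯ l_{i-1} l l'_{i+1} ⋯ l'_s` with
`l` Lyndon and `l < l_i`. -/
theorem stmt_19 {α : Type*} [LinearOrder α] [Fintype α] (u v : List α)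
    (hu : u ≠ []) (hv : v ≠ [])
    (L : List (List α)) (hvL : v = L.flatten) (hLlyndon : ∀ w ∈ L, IsLyndon w)
    (hLchain : L.Chain' (fun a b => b ≤ a)) :
    u < v ↔
      ∃ M : List (List α),
        u = M.flatten ∧ (∀ w ∈ M, IsLyndon w) ∧ M.Chain' (fun a b => b ≤ a) ∧
        ((∃ i : ℕ, 0 < i ∧ i < L.length ∧ M = L.take i) ∨
         (∃ (i : ℕ) (hi : i < L.length) (l : List α) (rest : List (List α)),
            M = L.take i ++ l :: rest ∧ l < L.get ⟨i, hi⟩)) := by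
  constructor
  · intro h
    obtain ⟨M, h1, h2, h3⟩ := aux_ex u
    refine ⟨M, h1, h2, h3, ?_⟩
    rw [h1, hvL] at h
    rcases aux_main_s19 M L hLlyndon hLchain h2 h3 h with ⟨i, hi, hM⟩ | h'
    · refine Or.inl ⟨i, ?_, hi, hM⟩
      rcases Nat.eq_zero_or_pos i with rfl | hp
      · simp at hM
        subst hM
        exact absurd h1 (by simpa using hu)
      · exact hp
    · exact Or.inr h'
  · rintro ⟨M, rfl, h2, h3, ⟨i, hi0, hi, rfl⟩ | ⟨i, hi, l, rest, rfl, hl⟩⟩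
    · have h4 : L = L.take i ++ L.drop i := (List.take_append_drop i L).symm
      rw [hvL]
      conv_rhs => rw [h4, List.flatten_append]
      conv_lhs => rw [← List.append_nil (L.take i).flatten]
      rw [aux_app, List.drop_eq_getElem_cons hi, List.flatten_cons]
      exact aux_nil_lt _ (by simp [(hLlyndon _ (List.getElem_mem hi)).1])
    · have h4 : L = L.take i ++ L.drop i := (List.take_append_drop i L).symm
      rw [hvL]
      conv_rhs => rw [h4, List.flatten_append]
      rw [List.flatten_append, aux_app, List.drop_eq_getElem_cons hi]
      exact aux_lt_s19 _ _ _ _ (hLlyndon _ (List.getElem_mem hi)) (List.IsChain.right_of_append h3) hl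
end
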